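/- arXiv:1402.4685 — 2 statements merged into one kernel-verified Lean document; each statement's English description precedes it below -/
import Mathlib

section
/- Let N ≥ 1 and let A⁰, A, L be real N×N matrices with A⁰ symmetric positive definite, A symmetric, L symmetric positive semidefinite, and suppose there is a real N×N matrix K such that K A⁰ is skew-symmetric and [K A]' + L is positive definite. Then there exist constants C > 0 and c > 0 such that for every r ∈ ℝ and every differentiable z : [0,∞) → ℂ^N solving A⁰ z'(t) + (i r A + L) z(t) = 0, one has |z(t)| ≤ C e^{−c r² t/(1+r²)} |z(0)| for all t ≥ 0. -/
open Matrix

/-- The action of a real `N × N` matrix on `ℂ^N`, via complexification. -/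
noncomputable def matC {N : ℕ} (M : Matrix (Fin N) (Fin N) ℝ) :
    EuclideanSpace ℂ (Fin N) →ₗ[ℂ] EuclideanSpace ℂ (Fin N) :=
  Matrix.toEuclideanLin (M.map (Complex.ofReal))

/-- The symmetric part `[X]' = (X + Xᵀ)/2` of a square matrix. -/
noncomputable def symPart {N : ℕ} (X : Matrix (Fin N) (Fin N) ℝ) : Matrix (Fin N) (Fin N) ℝ :=
  (2⁻¹ : ℝ) • (X + X.transpose)

/-- The derivative of the quadratic form of a symmetric operator along a differentiable curve. -/
theorem hasDerivAt_re_inner_symm {V : Type*} [NormedAddCommGroup V] [InnerProductSpace ℂ V]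
    (T : V →L[ℂ] V) (hT : ∀ x y, inner ℂ (T x) y = inner ℂ x (T y))
    {z : ℝ → V} {w : V} {t : ℝ} (hz : HasDerivAt z w t) :
    HasDerivAt (fun s => (inner ℂ (z s) (T (z s))).re) (2 * (inner ℂ (z t) (T w)).re) t := by
  have hTz : HasDerivAt (fun s => T (z s)) (T w) t :=
    (T.restrictScalars ℝ).hasFDerivAt.comp_hasDerivAt t hz
  have h := hz.inner ℂ hTz
  have h2 := Complex.reCLM.hasFDerivAt.comp_hasDerivAt t h
  have e : (inner ℂ w (T (z t))).re = (inner ℂ (z t) (T w)).re := by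
    rw [← hT, ← inner_conj_symm, Complex.conj_re]
  refine h2.congr_deriv ?_
  rw [Complex.reCLM_apply, Complex.add_re, e, two_mul]

/-- Grönwall's inequality on the half-line, for a differentiable function. -/
theorem le_mul_exp_of_hasDerivAt_le {F F' : ℝ → ℝ} {k : ℝ}
    (hF : ∀ t, 0 ≤ t → HasDerivAt F (F' t) t) (hle : ∀ t, 0 ≤ t → F' t ≤ -k * F t)
    {t : ℝ} (ht : 0 ≤ t) : F t ≤ F 0 * Real.exp (-k * t) := by
  have hG : ∀ s, 0 ≤ s → HasDerivAt (fun s => F s * Real.exp (k * s))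
      (F' s * Real.exp (k * s) + F s * (Real.exp (k * s) * k)) s := fun s hs => by
    have h1 : HasDerivAt (fun s : ℝ => k * s) k s := by
      simpa using (hasDerivAt_id s).const_mul k
    exact (hF s hs).mul h1.exp
  have hanti : AntitoneOn (fun s => F s * Real.exp (k * s)) (Set.Ici 0) := by
    apply antitoneOn_of_deriv_nonpos (convex_Ici 0)
    · exact fun s hs => (hG s hs).continuousAt.continuousWithinAt
    · intro s hs
      rw [interior_Ici] at hs
      exact (hG s hs.le).differentiableAt.differentiableWithinAt
    · intro s hs
      rw [interior_Ici] at hs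
      rw [(hG s hs.le).deriv]
      have := mul_le_mul_of_nonneg_right (hle s hs.le) (Real.exp_pos (k * s)).le
      linarith
  have h := hanti (Set.mem_Ici.2 le_rfl) (Set.mem_Ici.2 ht) ht
  simp only [mul_zero, Real.exp_zero, mul_one] at h
  rw [neg_mul, Real.exp_neg, ← div_eq_mul_inv, le_div_iff₀ (Real.exp_pos _)]
  exact h

/-- Scalar inequality controlling the cross term in the Lyapunov estimate. -/
theorem lyapunov_dissipation_le {r α δ k m ℓ x y : ℝ} (hα : 0 < α)
    (hδ : 0 < δ) (hℓ : 0 ≤ ℓ) (hy2 : y ^ 2 ≤ m * ℓ)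
    (hsmall : α * (1 + k ^ 2 * m / (2 * δ)) ≤ 1) {q p : ℝ}
    (hq : δ * x ^ 2 ≤ q + ℓ) (hp : |p| ≤ k * y * x) :
    -2 * ℓ - 2 * (α * r / (1 + r ^ 2)) * (r * q + p) ≤
      -(α * δ * (r ^ 2 / (1 + r ^ 2))) * x ^ 2 := by
  have hr : 0 < 1 + r ^ 2 := by positivity
  have h1 : -(r * p) ≤ δ * r ^ 2 * x ^ 2 / 2 + k ^ 2 * m * ℓ / (2 * δ) := by
    have h2 : -(r * p) ≤ |r| * (k * y * x) := by
      calc -(r * p) ≤ |r * p| := neg_le_abs _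
        _ = |r| * |p| := abs_mul _ _
        _ ≤ _ := by gcongr
    have h3 : |r| * (k * y * x) ≤ δ * r ^ 2 * x ^ 2 / 2 + k ^ 2 * y ^ 2 / (2 * δ) := by
      have : δ * r ^ 2 * x ^ 2 / 2 + k ^ 2 * y ^ 2 / (2 * δ) - |r| * (k * y * x)
          = (δ * |r| * x - k * y) ^ 2 / (2 * δ) := by
        rw [← sq_abs r]; field_simp; ring
      have : 0 ≤ (δ * |r| * x - k * y) ^ 2 / (2 * δ) := by positivity
      linarith
    have h4 : k ^ 2 * y ^ 2 / (2 * δ) ≤ k ^ 2 * m * ℓ / (2 * δ) := by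
      rw [mul_assoc]; gcongr
    linarith
  have h5 : -(r ^ 2 * q) ≤ r ^ 2 * ℓ - δ * r ^ 2 * x ^ 2 := by
    nlinarith [mul_le_mul_of_nonneg_left hq (sq_nonneg r)]
  have hk : 0 ≤ k ^ 2 * m * ℓ / (2 * δ) := by
    have : 0 ≤ k ^ 2 * (m * ℓ) := mul_nonneg (sq_nonneg k) ((sq_nonneg y).trans hy2)
    rw [mul_assoc]; positivity
  have h6 : α * (ℓ + k ^ 2 * m * ℓ / (2 * δ)) ≤ ℓ := by
    have := mul_le_mul_of_nonneg_right hsmall hℓ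
    calc _ = α * (1 + k ^ 2 * m / (2 * δ)) * ℓ := by ring
      _ ≤ _ := by linarith
  have key : -2 * ℓ * (1 + r ^ 2) - 2 * α * (r ^ 2 * q + r * p) ≤ -(α * δ * r ^ 2) * x ^ 2 := by
    have h7 := mul_le_mul_of_nonneg_left (add_le_add h1 h5) hα.le
    nlinarith [mul_nonneg (sq_nonneg r) hk, mul_nonneg hα.le (mul_nonneg (sq_nonneg r) hk),
      mul_le_mul_of_nonneg_left h6 (sq_nonneg r)]
  have e1 : -2 * ℓ - 2 * (α * r / (1 + r ^ 2)) * (r * q + p) =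
      (-2 * ℓ * (1 + r ^ 2) - 2 * α * (r ^ 2 * q + r * p)) / (1 + r ^ 2) := by
    field_simp
  have e2 : -(α * δ * (r ^ 2 / (1 + r ^ 2))) * x ^ 2 =
      (-(α * δ * r ^ 2) * x ^ 2) / (1 + r ^ 2) := by
    field_simp
  rw [e1, e2]
  gcongr

/-- Uniform decay estimate for the system `P ∂ₜz + (i r Q + R) z = 0` with a compensating operator `K`. -/
theorem exists_decay_of_compensator {V : Type*} [NormedAddCommGroup V] [InnerProductSpace ℂ V]
    (P Q R K : V →L[ℂ] V) (hP : ∀ x y, inner ℂ (P x) y = inner ℂ x (P y))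
    (hQ : ∀ x y, inner ℂ (Q x) y = inner ℂ x (Q y))
    (hK : ∀ x y, inner ℂ (K (P x)) y = -inner ℂ x (K (P y)))
    {a δ m : ℝ} (ha : 0 < a) (hδ : 0 < δ) (hm : 0 ≤ m)
    (hPa : ∀ x, a * ‖x‖ ^ 2 ≤ (inner ℂ x (P x)).re)
    (hKQ : ∀ x, δ * ‖x‖ ^ 2 ≤ (inner ℂ x (K (Q x))).re + (inner ℂ x (R x)).re)
    (hR0 : ∀ x, 0 ≤ (inner ℂ x (R x)).re)
    (hR : ∀ x, ‖R x‖ ^ 2 ≤ m * (inner ℂ x (R x)).re) :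
    ∃ C c : ℝ, 0 < C ∧ 0 < c ∧ ∀ (r : ℝ) (z z' : ℝ → V),
      (∀ t : ℝ, 0 ≤ t → HasDerivAt z (z' t) t) →
      (∀ t : ℝ, 0 ≤ t → P (z' t) + ((Complex.I * (r : ℂ)) • Q (z t) + R (z t)) = 0) →
      ∀ t : ℝ, 0 ≤ t →
        ‖z t‖ ≤ C * Real.exp (-(c * r ^ 2 * t) / (1 + r ^ 2)) * ‖z 0‖ := by
  set S : V →L[ℂ] V := Complex.I • (K.comp P) with hS
  have hSsymm : ∀ x y, inner ℂ (S x) y = inner ℂ x (S y) := fun x y => by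
    simp [hS, hK, mul_comm]
  set b : ℝ := 1 + ‖K‖ ^ 2 * m / (2 * δ) with hb
  have hb0 : 0 < b := by positivity
  set α : ℝ := min b⁻¹ (a / (2 * (‖S‖ + 1))) with hαdef
  have hα : 0 < α := by positivity
  have hαb : α * b ≤ 1 := by
    calc α * b ≤ b⁻¹ * b := by gcongr; exact min_le_left _ _
      _ = 1 := inv_mul_cancel₀ hb0.ne'
  have hαS : α * ‖S‖ ≤ a / 2 := by
    calc α * ‖S‖ ≤ a / (2 * (‖S‖ + 1)) * (‖S‖ + 1) := by
          gcongr
          · exact min_le_right _ _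
          · linarith
      _ = a / 2 := by field_simp
  set M : ℝ := ‖P‖ + a with hM
  have hM0 : 0 < M := by positivity
  have hbound : ∀ (T : V →L[ℂ] V) (x : V), |(inner ℂ x (T x)).re| ≤ ‖T‖ * ‖x‖ ^ 2 := by
    intro T x
    calc |(inner ℂ x (T x)).re| ≤ ‖inner ℂ x (T x)‖ := Complex.abs_re_le_norm _
      _ ≤ ‖x‖ * ‖T x‖ := norm_inner_le_norm _ _
      _ ≤ ‖x‖ * (‖T‖ * ‖x‖) := by gcongr; exact T.le_opNorm x
      _ = _ := by ring
  refine ⟨Real.sqrt (2 * M / a), α * δ / (2 * M), by positivity, by positivity, ?_⟩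
  intro r z z' hz heq t ht
  have hr : 0 < 1 + r ^ 2 := by positivity
  set β : ℝ := α * r / (1 + r ^ 2) with hβ
  have hβabs : |β| ≤ α := by
    rw [hβ, abs_div, abs_mul, abs_of_pos hα, abs_of_pos hr, div_le_iff₀ hr]
    have : |r| ≤ 1 + r ^ 2 := by nlinarith [sq_abs r, sq_nonneg (|r| - 1)]
    gcongr
  set F : ℝ → ℝ := fun s => (inner ℂ (z s) (P (z s))).re - β * (inner ℂ (z s) (S (z s))).re
    with hFdef
  have hβS : ∀ x, |β * (inner ℂ x (S x)).re| ≤ a / 2 * ‖x‖ ^ 2 := fun x => by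
    rw [abs_mul]
    calc |β| * |(inner ℂ x (S x)).re| ≤ α * (‖S‖ * ‖x‖ ^ 2) := by gcongr; exact hbound S x
      _ = α * ‖S‖ * ‖x‖ ^ 2 := by ring
      _ ≤ _ := by gcongr
  have hFlow : ∀ s, a / 2 * ‖z s‖ ^ 2 ≤ F s := fun s => by
    have h1 := (abs_le.1 (hβS (z s))).2
    have h2 := hPa (z s)
    simp only [hFdef]; linarith
  have hFup : ∀ s, F s ≤ M * ‖z s‖ ^ 2 := fun s => by
    have h1 := (abs_le.1 (hβS (z s))).1
    have h2 := (abs_le.1 (hbound P (z s))).2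
    have h3 : 0 ≤ a * ‖z s‖ ^ 2 := by positivity
    simp only [hFdef, hM]; linarith
  have hFder : ∀ s, 0 ≤ s → HasDerivAt F (2 * (inner ℂ (z s) (P (z' s))).re
      - β * (2 * (inner ℂ (z s) (S (z' s))).re)) s := fun s hs =>
    (hasDerivAt_re_inner_symm P hP (hz s hs)).sub
      ((hasDerivAt_re_inner_symm S hSsymm (hz s hs)).const_mul β)
  have hFle : ∀ s, 0 ≤ s → 2 * (inner ℂ (z s) (P (z' s))).re
      - β * (2 * (inner ℂ (z s) (S (z' s))).re)
      ≤ -(α * δ / M * (r ^ 2 / (1 + r ^ 2))) * F s := fun s hs => by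
    set x := z s
    have hPz : P (z' s) = -((Complex.I * (r : ℂ)) • Q x + R x) :=
      eq_neg_of_add_eq_zero_left (heq s hs)
    have hQim : (inner ℂ x (Q x)).im = 0 := by
      rw [← Complex.conj_eq_iff_im, inner_conj_symm, hQ]
    have h1 : (inner ℂ x (P (z' s))).re = -(inner ℂ x (R x)).re := by
      rw [hPz]
      simp [inner_smul_right, inner_neg_right, hQim]
    have h2 : (inner ℂ x (S (z' s))).re =
        r * (inner ℂ x (K (Q x))).re + (inner ℂ x (K (R x))).im := by
      have : S (z' s) = Complex.I • K (P (z' s)) := rfl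
      rw [this, hPz]
      simp [inner_smul_right, inner_neg_right, add_comm]
    have hp : |(inner ℂ x (K (R x))).im| ≤ ‖K‖ * ‖R x‖ * ‖x‖ := by
      calc |(inner ℂ x (K (R x))).im| ≤ ‖inner ℂ x (K (R x))‖ := Complex.abs_im_le_norm _
        _ ≤ ‖x‖ * ‖K (R x)‖ := norm_inner_le_norm _ _
        _ ≤ ‖x‖ * (‖K‖ * ‖R x‖) := by gcongr; exact K.le_opNorm _
        _ = _ := by ring
    have h3 := lyapunov_dissipation_le (r := r) hα hδ (hR0 x) (hR x) hαb (hKQ x) hp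
    rw [h1, h2]
    calc _ = -2 * (inner ℂ x (R x)).re - 2 * (α * r / (1 + r ^ 2)) *
          (r * (inner ℂ x (K (Q x))).re + (inner ℂ x (K (R x))).im) := by rw [hβ]; ring
      _ ≤ -(α * δ * (r ^ 2 / (1 + r ^ 2))) * ‖x‖ ^ 2 := h3
      _ = -(α * δ / M * (r ^ 2 / (1 + r ^ 2)) * (M * ‖x‖ ^ 2)) := by field_simp
      _ ≤ -(α * δ / M * (r ^ 2 / (1 + r ^ 2)) * F s) := by
          gcongr
          exact hFup s
      _ = _ := by ring
  have hG := le_mul_exp_of_hasDerivAt_le hFder hFle ht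
  set e := Real.exp (-(α * δ / (2 * M) * r ^ 2 * t) / (1 + r ^ 2)) with he
  have he2 : Real.exp (-(α * δ / M * (r ^ 2 / (1 + r ^ 2))) * t) = e ^ 2 := by
    rw [he, ← Real.exp_nat_mul]
    congr 1
    push_cast
    field_simp
  rw [he2] at hG
  refine le_of_sq_le_sq ?_ (by positivity)
  rw [mul_pow, mul_pow, Real.sq_sqrt (by positivity)]
  have h4 : a / 2 * ‖z t‖ ^ 2 ≤ M * ‖z 0‖ ^ 2 * e ^ 2 :=
    ((hFlow t).trans hG).trans (by gcongr; exact hFup 0)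
  calc ‖z t‖ ^ 2 = 2 / a * (a / 2 * ‖z t‖ ^ 2) := by field_simp
    _ ≤ 2 / a * (M * ‖z 0‖ ^ 2 * e ^ 2) := by gcongr
    _ = _ := by ring

theorem matC_mul {N : ℕ} (M P : Matrix (Fin N) (Fin N) ℝ) (x : EuclideanSpace ℂ (Fin N)) :
    matC (M * P) x = matC M (matC P x) := by
  have h : (M * P).map Complex.ofReal = M.map Complex.ofReal * P.map Complex.ofReal :=
    Matrix.map_mul (f := Complex.ofRealHom)
  simp only [matC, h]
  rw [Matrix.toLpLin_mul_same]
  rfl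

theorem matC_add {N : ℕ} (M P : Matrix (Fin N) (Fin N) ℝ) (x : EuclideanSpace ℂ (Fin N)) :
    matC (M + P) x = matC M x + matC P x := by
  simp [matC, Matrix.map_add]

theorem matC_neg {N : ℕ} (M : Matrix (Fin N) (Fin N) ℝ) (x : EuclideanSpace ℂ (Fin N)) :
    matC (-M) x = -matC M x := by
  have h : (-M).map Complex.ofReal = -M.map Complex.ofReal := by ext; simp
  simp [matC, h]

theorem matC_smul {N : ℕ} (a : ℝ) (M : Matrix (Fin N) (Fin N) ℝ) (x : EuclideanSpace ℂ (Fin N)) :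
    matC (a • M) x = (a : ℂ) • matC M x := by
  have h : (a • M).map Complex.ofReal = (a : ℂ) • M.map Complex.ofReal := by ext; simp
  simp only [matC, h, map_smul, LinearMap.smul_apply]

theorem matC_one {N : ℕ} (x : EuclideanSpace ℂ (Fin N)) : matC 1 x = x := by
  have h : (1 : Matrix (Fin N) (Fin N) ℝ).map Complex.ofReal = 1 :=
    Matrix.map_one _ Complex.ofReal_zero Complex.ofReal_one
  simp [matC, h]

/-- The adjoint of the complexification of a real matrix is that of its transpose. -/
theorem inner_matC_left {N : ℕ} (M : Matrix (Fin N) (Fin N) ℝ) (x y : EuclideanSpace ℂ (Fin N)) :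
    inner ℂ (matC M x) y = inner ℂ x (matC M.transpose y) := by
  have h : M.transpose.map Complex.ofReal = (M.map Complex.ofReal).conjTranspose := by
    ext; simp
  simp only [matC, h]
  rw [Matrix.toEuclideanLin_conjTranspose_eq_adjoint, LinearMap.adjoint_inner_right]

theorem inner_matC_symPart_re {N : ℕ} (M : Matrix (Fin N) (Fin N) ℝ)
    (x : EuclideanSpace ℂ (Fin N)) :
    (inner ℂ x (matC (symPart M) x)).re = (inner ℂ x (matC M x)).re := by
  have h : (inner ℂ x (matC M.transpose x)).re = (inner ℂ x (matC M x)).re := by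
    rw [← inner_matC_left, ← inner_conj_symm, Complex.conj_re]
  rw [symPart, matC_smul, matC_add, inner_smul_right, inner_add_right, Complex.re_ofReal_mul,
    Complex.add_re, h]
  ring

open scoped MatrixOrder Matrix.Norms.L2Operator in
theorem exists_eq_transpose_mul_self {N : ℕ} {M : Matrix (Fin N) (Fin N) ℝ}
    (hM : M.PosSemidef) : ∃ B : Matrix (Fin N) (Fin N) ℝ, M = B.transpose * B := by
  obtain ⟨B, hB⟩ := CStarAlgebra.nonneg_iff_eq_star_mul_self.mp hM.nonneg
  rw [Matrix.star_eq_conjTranspose, Matrix.conjTranspose_eq_transpose_of_trivial] at hB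
  exact ⟨B, hB⟩

theorem inner_matC_transpose_mul_self_re {N : ℕ} (B : Matrix (Fin N) (Fin N) ℝ)
    (x : EuclideanSpace ℂ (Fin N)) :
    (inner ℂ x (matC (B.transpose * B) x)).re = ‖matC B x‖ ^ 2 := by
  rw [matC_mul, ← inner_matC_left, inner_self_eq_norm_sq_to_K]
  norm_cast

theorem exists_norm_matC_le {N : ℕ} (M : Matrix (Fin N) (Fin N) ℝ) :
    ∃ k : ℝ, 0 < k ∧ ∀ x, ‖matC M x‖ ≤ k * ‖x‖ := by
  refine ⟨‖(matC M).toContinuousLinearMap‖ + 1, by positivity, fun x => ?_⟩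
  have := (matC M).toContinuousLinearMap.le_opNorm x
  rw [LinearMap.coe_toContinuousLinearMap'] at this
  linarith [norm_nonneg x]

theorem Matrix.PosDef.exists_le_inner_matC {N : ℕ} {M : Matrix (Fin N) (Fin N) ℝ}
    (hM : M.PosDef) :
    ∃ a : ℝ, 0 < a ∧ ∀ x, a * ‖x‖ ^ 2 ≤ (inner ℂ x (matC M x)).re := by
  obtain ⟨B, hB⟩ := exists_eq_transpose_mul_self hM.posSemidef
  have hu : IsUnit B.det := by
    have h := hM.det_pos
    rw [hB, Matrix.det_mul, Matrix.det_transpose] at h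
    exact isUnit_iff_ne_zero.2 fun h0 => by simp [h0] at h
  obtain ⟨k, hk, hkle⟩ := exists_norm_matC_le B⁻¹
  refine ⟨(k ^ 2)⁻¹, by positivity, fun x => ?_⟩
  rw [hB, inner_matC_transpose_mul_self_re, inv_mul_le_iff₀ (by positivity), ← mul_pow]
  have h := hkle (matC B x)
  rw [← matC_mul, Matrix.nonsing_inv_mul B hu, matC_one] at h
  gcongr

theorem Matrix.PosSemidef.inner_matC_nonneg {N : ℕ} {M : Matrix (Fin N) (Fin N) ℝ}
    (hM : M.PosSemidef) (x : EuclideanSpace ℂ (Fin N)) : 0 ≤ (inner ℂ x (matC M x)).re := by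
  obtain ⟨B, rfl⟩ := exists_eq_transpose_mul_self hM
  rw [inner_matC_transpose_mul_self_re]
  positivity

theorem Matrix.PosSemidef.exists_norm_matC_sq_le {N : ℕ} {M : Matrix (Fin N) (Fin N) ℝ}
    (hM : M.PosSemidef) :
    ∃ m : ℝ, 0 ≤ m ∧ ∀ x, ‖matC M x‖ ^ 2 ≤ m * (inner ℂ x (matC M x)).re := by
  obtain ⟨B, rfl⟩ := exists_eq_transpose_mul_self hM
  obtain ⟨k, hk, hkle⟩ := exists_norm_matC_le B.transpose
  refine ⟨k ^ 2, by positivity, fun x => ?_⟩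
  rw [inner_matC_transpose_mul_self_re, matC_mul, ← mul_pow]
  gcongr
  exact hkle _

theorem statement3 (N : ℕ) (hN : 1 ≤ N)
    (A0 A L K : Matrix (Fin N) (Fin N) ℝ)
    (hA0 : A0.PosDef) (hA0s : A0.IsSymm) (hA : A.IsSymm)
    (hL : L.PosSemidef) (hLs : L.IsSymm)
    (hKskew : (K * A0).transpose = -(K * A0))
    (hKA : (symPart (K * A) + L).PosDef) :
    ∃ C c : ℝ, 0 < C ∧ 0 < c ∧
      ∀ (r : ℝ) (z z' : ℝ → EuclideanSpace ℂ (Fin N)),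
        (∀ t : ℝ, 0 ≤ t → HasDerivAt z (z' t) t) →
        (∀ t : ℝ, 0 ≤ t →
          matC A0 (z' t) + ((Complex.I * (r : ℂ)) • matC A (z t) + matC L (z t)) = 0) →
        ∀ t : ℝ, 0 ≤ t →
          ‖z t‖ ≤ C * Real.exp (-(c * r ^ 2 * t) / (1 + r ^ 2)) * ‖z 0‖ := by
  obtain ⟨a, ha, hPa⟩ := hA0.exists_le_inner_matC
  obtain ⟨δ, hδ, hKQ⟩ := hKA.exists_le_inner_matC
  obtain ⟨m, hm, hR⟩ := hL.exists_norm_matC_sq_le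
  refine exists_decay_of_compensator (matC A0).toContinuousLinearMap
    (matC A).toContinuousLinearMap (matC L).toContinuousLinearMap
    (matC K).toContinuousLinearMap (fun x y => ?_) (fun x y => ?_) (fun x y => ?_) ha hδ hm hPa
    (fun x => ?_) hL.inner_matC_nonneg hR
  · simp only [LinearMap.coe_toContinuousLinearMap']
    rw [inner_matC_left, hA0s.eq]
  · simp only [LinearMap.coe_toContinuousLinearMap']
    rw [inner_matC_left, hA.eq]
  · simp only [LinearMap.coe_toContinuousLinearMap']
    rw [← matC_mul, ← matC_mul, inner_matC_left, hKskew, matC_neg, inner_neg_right]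
  · simp only [LinearMap.coe_toContinuousLinearMap']
    rw [← matC_mul, ← inner_matC_symPart_re, ← Complex.add_re, ← inner_add_right, ← matC_add]
    exact hKQ x
end

section
/- Assume the [SK]-hypothesis: there is a continuous map K from the unit sphere S^{n−1} to the real N×N matrices such that for every ω ∈ S^{n−1}, K(−ω) = −K(ω), K(ω)A⁰ is skew-symmetric, and [K(ω)A(ω)]' + L is positive definite. Then for every p ∈ [1,2) there exists a constant C > 0, depending only on n, p and the matrices A⁰, A¹, …, Aⁿ, L, K, such that every solution w of the linear system satisfies, for all t ≥ 0, ‖w(t,·)‖_{L²(ℝⁿ)} ≤ C (1+t)^{−(n/2)(1/p − 1/2)} ( ‖w₀‖_{L²(ℝⁿ)} + ‖w₀‖_{L^p(ℝⁿ)} ). -/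
open scoped ENNReal
open MeasureTheory Matrix

section Baire

/-- A compact set of points near which `N` is bounded above has bounded image. -/
theorem bddAbove_image_of_eventually_le {N : ℝ → ℝ} {k : Set ℝ} (hk : IsCompact k)
    (h : ∀ t ∈ k, ∃ M, ∀ᶠ s in nhds t, N s ≤ M) : BddAbove (N '' k) := by
  refine hk.induction_on (p := fun s => BddAbove (N '' s)) (by simp)
    (fun s t hst ht => ht.mono (Set.image_mono hst))
    (fun s t hs ht => by rw [Set.image_union]; exact hs.union ht) fun t ht => ?_
  obtain ⟨M, hM⟩ := h t ht
  exact ⟨_, mem_nhdsWithin_of_mem_nhds hM, M, by rintro _ ⟨s, hs, rfl⟩; exact hs⟩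

/-- A nonnegative lower semicontinuous function that satisfies a two-sided Grönwall-type estimate
on every interval on which it is bounded is bounded on every compact interval. -/
theorem bddAbove_image_uIcc_of_propagation {N : ℝ → ℝ} {C c : ℝ} (hC : 0 ≤ C) (hc : 0 ≤ c)
    (hN : ∀ t, 0 ≤ N t) (hclosed : ∀ M, IsClosed {t | N t ≤ M})
    (h : ∀ a b, BddAbove (N '' Set.uIcc a b) → N b ≤ C * Real.exp (c * |b - a|) * N a)
    (a b : ℝ) : BddAbove (N '' Set.uIcc a b) := by
  set U : Set ℝ := {t | ∃ M, ∀ᶠ s in nhds t, N s ≤ M} with hU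
  have hUo : IsOpen U := by
    refine isOpen_iff_eventually.2 fun t ⟨M, hM⟩ => ?_
    filter_upwards [hM.eventually_nhds] with s hs using ⟨M, hs⟩
  have hprop : ∀ a t, (∀ s ∈ Set.uIcc a t, s ≠ a → s ∈ U) →
      N t ≤ C * Real.exp (c * |t - a|) * N a := by
    intro a t hs
    refine h a t ⟨max (N a) (C * Real.exp (c * |t - a|) * N t), ?_⟩
    rintro _ ⟨s, hsm, rfl⟩
    by_cases hsa : s = a
    · subst hsa; exact le_max_left _ _
    · refine le_max_of_le_right ?_
      have hdist : |s - t| ≤ |t - a| := by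
        rw [abs_sub_comm s t]; exact Set.abs_sub_right_of_mem_uIcc hsm
      have hsub : ∀ r ∈ Set.uIcc t s, r ∈ U := by
        intro r hr
        rw [Set.uIcc_comm] at hr
        refine hs r (Set.uIcc_subset_uIcc_right hsm hr) ?_
        rintro rfl
        rcases Set.mem_uIcc.1 hr with h1 | h1 <;> rcases Set.mem_uIcc.1 hsm with h2 | h2 <;>
          exact hsa (by linarith)
      have := h t s (bddAbove_image_of_eventually_le isCompact_uIcc hsub)
      refine this.trans ?_
      have := hN t
      gcongr
  suffices hE : ∀ t, t ∈ U from bddAbove_image_of_eventually_le isCompact_uIcc fun t _ => hE t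
  by_contra! hne
  obtain ⟨t₁, ht₁⟩ := hne
  have : CompleteSpace (Uᶜ : Set ℝ) := hUo.isClosed_compl.completeSpace_coe
  have : Nonempty (Uᶜ : Set ℝ) := ⟨⟨t₁, ht₁⟩⟩
  obtain ⟨m, ⟨t₀, hU₀⟩, hm⟩ := nonempty_interior_of_iUnion_of_closed
    (X := (Uᶜ : Set ℝ)) (f := fun m : ℕ => {t | N t ≤ m})
    (fun m => (hclosed m).preimage continuous_subtype_val)
    (by ext t; simpa using exists_nat_ge (N t))
  rw [mem_interior_iff_mem_nhds, Metric.mem_nhds_iff] at hm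
  obtain ⟨δ, hδ, hm⟩ := hm
  refine hU₀ ⟨max m (C * Real.exp (c * δ) * m), ?_⟩
  filter_upwards [Metric.ball_mem_nhds t₀ hδ] with t ht
  obtain ⟨r, ⟨hr, hrE⟩, hmin⟩ := (isCompact_uIcc.inter_right hUo.isClosed_compl).exists_isMinOn
    ⟨t₀, Set.left_mem_uIcc (b := t), hU₀⟩ (f := fun s => |s - t|) (by fun_prop)
  rw [Metric.mem_ball, Real.dist_eq] at ht
  have hr₀ : N r ≤ m := by
    refine @hm ⟨r, hrE⟩ ?_
    rw [Metric.mem_ball, Subtype.dist_eq, Real.dist_eq]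
    exact (Set.abs_sub_left_of_mem_uIcc hr).trans_lt ht
  have hrt : |t - r| ≤ δ := (Set.abs_sub_right_of_mem_uIcc hr).trans ht.le
  refine le_max_of_le_right ((hprop r t fun s hs hsr => ?_).trans ?_)
  · by_contra hsU
    have h1 : |r - t| ≤ |s - t| := hmin ⟨Set.uIcc_subset_uIcc_right hr hs, hsU⟩
    rcases Set.mem_uIcc.1 hs with h2 | h2
    · rw [abs_of_nonpos (by linarith), abs_of_nonpos (by linarith)] at h1
      exact hsr (by linarith)
    · rw [abs_of_nonneg (by linarith), abs_of_nonneg (by linarith)] at h1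
      exact hsr (by linarith)
  · have := hN r
    gcongr

end Baire

open scoped SchwartzMap FourierTransform

section Joint

set_option linter.unusedSectionVars false

variable {E V : Type*} [NormedAddCommGroup E] [InnerProductSpace ℝ E] [FiniteDimensional ℝ E]
  [MeasurableSpace E] [BorelSpace E] [NormedAddCommGroup V] [InnerProductSpace ℂ V]
  [CompleteSpace V]

theorem stronglyMeasurable_uncurry_schwartz {h : ℝ → 𝓢(E, V)}
    (hc : ∀ x, Continuous fun t => h t x) :
    StronglyMeasurable (Function.uncurry fun t x => h t x) :=
  stronglyMeasurable_uncurry_of_continuous_of_stronglyMeasurable hc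
    fun t => (h t).continuous.stronglyMeasurable

theorem stronglyMeasurable_uncurry_fourier {h : ℝ → 𝓢(E, V)}
    (hm : StronglyMeasurable (Function.uncurry fun t x => h t x)) :
    StronglyMeasurable (Function.uncurry fun t ξ => 𝓕 (h t) ξ) := by
  have : (Function.uncurry fun t ξ => 𝓕 (h t) ξ) =
      fun p : ℝ × E => ∫ v, Real.fourierChar (-inner ℝ v p.2) • h p.1 v := by
    ext ⟨t, ξ⟩
    simp only [Function.uncurry, SchwartzMap.fourier_coe, Real.fourier_eq]
  rw [this]
  refine StronglyMeasurable.integral_prod_right' (f := fun q : (ℝ × E) × E =>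
    Real.fourierChar (-inner ℝ q.2 q.1.2) • h q.1.1 q.2) ?_
  simp only [Circle.smul_def]
  refine StronglyMeasurable.smul (𝕜 := ℂ) ?_ ?_
  · exact Continuous.stronglyMeasurable (continuous_subtype_val.comp
      (Real.continuous_fourierChar.comp (by fun_prop)))
  · exact hm.comp_measurable (g := fun q : (ℝ × E) × E => (q.1.1, q.2)) (by fun_prop)

/-- A family of Schwartz functions that is bounded in `L²` on an interval is jointly in `L²`. -/
theorem memLp_two_uncurry {h : ℝ → 𝓢(E, V)} {a b M : ℝ}
    (hm : StronglyMeasurable (Function.uncurry fun t x => h t x))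
    (hM : ∀ t ∈ Set.uIoc a b, ∫ x, ‖h t x‖ ^ 2 ≤ M) :
    MemLp (Function.uncurry fun t x => h t x) 2
      ((volume.restrict (Set.uIoc a b)).prod (volume : Measure E)) := by
  have : IsFiniteMeasure (volume.restrict (Set.uIoc a b)) :=
    ⟨by rw [Measure.restrict_apply_univ, Set.uIoc]; exact measure_Ioc_lt_top⟩
  have hm2 : StronglyMeasurable fun p : ℝ × E =>
    ‖Function.uncurry (fun t x => h t x) p‖ ^ 2 := hm.norm.pow 2
  rw [memLp_two_iff_integrable_sq_norm hm.aestronglyMeasurable,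
    integrable_prod_iff hm2.aestronglyMeasurable]
  refine ⟨Filter.Eventually.of_forall fun t => ?_, ?_⟩
  · exact (memLp_two_iff_integrable_sq_norm (h t).continuous.aestronglyMeasurable).1
      ((h t).memLp 2)
  · refine Integrable.of_bound (C := M) hm2.norm.integral_prod_right'.aestronglyMeasurable ?_
    refine (ae_restrict_iff' measurableSet_uIoc).2 (Filter.Eventually.of_forall fun t ht => ?_)
    simp only [Function.uncurry, norm_pow, norm_norm]
    rw [Real.norm_of_nonneg (by positivity)]
    exact hM t ht

theorem integrable_smul_uncurry {h : ℝ → 𝓢(E, V)} {a b : ℝ}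
    (hL : MemLp (Function.uncurry fun t x => h t x) 2
      ((volume.restrict (Set.uIoc a b)).prod (volume : Measure E))) (φ : 𝓢(E, ℂ)) :
    Integrable (Function.uncurry fun t x => φ x • h t x)
      ((volume.restrict (Set.uIoc a b)).prod (volume : Measure E)) := by
  have : IsFiniteMeasure (volume.restrict (Set.uIoc a b)) :=
    ⟨by rw [Measure.restrict_apply_univ, Set.uIoc]; exact measure_Ioc_lt_top⟩
  have hφ : MemLp (fun p : ℝ × E => φ p.2) 2
      ((volume.restrict (Set.uIoc a b)).prod (volume : Measure E)) := (φ.memLp 2).comp_snd _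
  rw [← memLp_one_iff_integrable]
  exact hL.smul (r := 1) hφ

theorem ae_integrableOn_of_memLp_two {u : ℝ → E → V} {a b : ℝ}
    (hm : StronglyMeasurable (Function.uncurry u))
    (hL : MemLp (Function.uncurry u) 2
      ((volume.restrict (Set.uIoc a b)).prod (volume : Measure E))) :
    ∀ᵐ x, IntegrableOn (fun t => u t x) (Set.uIoc a b) := by
  have : IsFiniteMeasure (volume.restrict (Set.uIoc a b)) :=
    ⟨by rw [Measure.restrict_apply_univ, Set.uIoc]; exact measure_Ioc_lt_top⟩
  have hi := ((memLp_two_iff_integrable_sq_norm hm.aestronglyMeasurable).1 hL).prod_left_ae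
  filter_upwards [hi] with x hx
  have hmx : StronglyMeasurable fun t => u t x := hm.comp_measurable (by fun_prop :
    Measurable fun t : ℝ => (t, x))
  exact ((memLp_two_iff_integrable_sq_norm hmx.aestronglyMeasurable).2 hx).integrable
    (by norm_num)

theorem locallyIntegrable_intervalIntegral {u : ℝ → E → V} {a b : ℝ}
    (hL : MemLp (Function.uncurry u) 2
      ((volume.restrict (Set.uIoc a b)).prod (volume : Measure E))) :
    LocallyIntegrable fun x => ∫ t in a..b, u t x := by
  have : IsFiniteMeasure (volume.restrict (Set.uIoc a b)) :=
    ⟨by rw [Measure.restrict_apply_univ, Set.uIoc]; exact measure_Ioc_lt_top⟩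
  rw [locallyIntegrable_iff]
  intro k hk
  have : IsFiniteMeasure ((volume : Measure E).restrict k) :=
    ⟨by rw [Measure.restrict_apply_univ]; exact hk.measure_lt_top⟩
  have hle : (volume.restrict (Set.uIoc a b)).prod ((volume : Measure E).restrict k) ≤
      (volume.restrict (Set.uIoc a b)).prod (volume : Measure E) :=
    Measure.prod_mono le_rfl Measure.restrict_le_self
  have hi := ((hL.mono_measure hle).integrable (by norm_num)).integral_prod_right
  simp only [intervalIntegral.intervalIntegral_eq_integral_uIoc]
  exact hi.smul _

/-- If `f` is the pointwise time primitive of `g` and `g` is bounded in `L²`, then the same holds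
for the Fourier transforms, almost everywhere in frequency. -/
theorem ae_fourier_eq_add_integral {f g : ℝ → 𝓢(E, V)} {a b M : ℝ}
    (hg : ∀ x, Continuous fun t => g t x)
    (hfg : ∀ x, f b x = f a x + ∫ t in a..b, g t x)
    (hM : ∀ t ∈ Set.uIoc a b, ∫ x, ‖g t x‖ ^ 2 ≤ M) :
    ∀ᵐ ξ, 𝓕 (f b) ξ = 𝓕 (f a) ξ + ∫ t in a..b, 𝓕 (g t) ξ := by
  have hmg := stronglyMeasurable_uncurry_schwartz hg
  have hLg := memLp_two_uncurry hmg hM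
  have hLG := memLp_two_uncurry (h := fun t => 𝓕 (g t)) (stronglyMeasurable_uncurry_fourier hmg)
    (fun t ht => (SchwartzMap.integral_norm_sq_fourier (g t)).trans_le (hM t ht))
  have hloc := locallyIntegrable_intervalIntegral hLG
  refine ae_eq_of_integral_contDiff_smul_eq (𝓕 (f b)).continuous.locallyIntegrable
    ((𝓕 (f a)).continuous.locallyIntegrable.add hloc) fun φ₀ hφ₀ hcφ₀ => ?_
  have hφ₁ : HasCompactSupport fun x => (φ₀ x : ℂ) := hcφ₀.comp_left Complex.ofReal_zero
  let φ : 𝓢(E, ℂ) := hφ₁.toSchwartzMap (Complex.ofRealCLM.contDiff.comp hφ₀)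
  have hφ : ∀ x (v : V), φ₀ x • v = φ x • v := fun x v => by
    change _ = (φ₀ x : ℂ) • v
    rw [Complex.coe_smul]
  simp only [hφ]
  have hI : ∀ (χ : 𝓢(E, ℂ)) (k : 𝓢(E, V)), Integrable fun x => χ x • k x := fun χ k => by
    rw [← memLp_one_iff_integrable]
    exact (k.memLp 2).smul (r := 1) (χ.memLp 2)
  have e1 : ∀ k : 𝓢(E, V), ∫ x, φ x • 𝓕 k x = ∫ x, 𝓕 φ x • k x :=
    fun k => (SchwartzMap.integral_fourier_smul_eq φ k).symm
  have hsw1 : ∫ t in a..b, ∫ x, 𝓕 φ x • g t x = ∫ x, 𝓕 φ x • ∫ t in a..b, g t x := by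
    rw [intervalIntegral_integral_swap (integrable_smul_uncurry hLg (𝓕 φ))]
    simp only [intervalIntegral.integral_smul]
  have hsw2 : ∫ t in a..b, ∫ x, φ x • 𝓕 (g t) x = ∫ x, φ x • ∫ t in a..b, 𝓕 (g t) x := by
    rw [intervalIntegral_integral_swap (integrable_smul_uncurry hLG φ)]
    simp only [intervalIntegral.integral_smul]
  have hi1 : Integrable fun x => 𝓕 φ x • ∫ t in a..b, g t x := by
    have := (integrable_smul_uncurry hLg (𝓕 φ)).integral_prod_right.smul
      (if a ≤ b then (1 : ℝ) else -1)
    simpa only [Function.uncurry, ← intervalIntegral.intervalIntegral_eq_integral_uIoc,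
      Pi.smul_def, intervalIntegral.integral_smul] using this
  have hi2 : Integrable fun x => φ x • ∫ t in a..b, 𝓕 (g t) x := by
    have := (integrable_smul_uncurry hLG φ).integral_prod_right.smul
      (if a ≤ b then (1 : ℝ) else -1)
    simpa only [Function.uncurry, ← intervalIntegral.intervalIntegral_eq_integral_uIoc,
      Pi.smul_def, intervalIntegral.integral_smul] using this
  have : ∫ x, φ x • (𝓕 (f a) + fun ξ => ∫ t in a..b, 𝓕 (g t) ξ : E → V) x =
      (∫ x, φ x • 𝓕 (f a) x) + ∫ x, φ x • ∫ t in a..b, 𝓕 (g t) x := by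
    rw [← integral_add (hI _ _) hi2]
    simp [smul_add]
  refine Eq.trans ?_ this.symm
  rw [e1, ← hsw2, e1]
  simp only [e1]
  rw [hsw1, ← integral_add (hI _ _) hi1]
  simp only [hfg, smul_add]

theorem stronglyMeasurable_intervalIntegral {u : ℝ → E → V} (a : ℝ)
    (hm : StronglyMeasurable (Function.uncurry u)) :
    StronglyMeasurable fun p : ℝ × E => ∫ r in a..p.1, u r p.2 := by
  simp only [intervalIntegral]
  have key : ∀ s : Set ((ℝ × E) × ℝ), MeasurableSet s →
      StronglyMeasurable fun p : ℝ × E => ∫ r, s.indicator (fun q => u q.2 q.1.2) (p, r) := by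
    intro s hs
    refine StronglyMeasurable.integral_prod_right' (StronglyMeasurable.indicator ?_ hs)
    exact hm.comp_measurable (g := fun q : (ℝ × E) × ℝ => (q.2, q.1.2)) (by fun_prop)
  have h1 := key {q | a < q.2 ∧ q.2 ≤ q.1.1} (by measurability)
  have h2 := key {q | q.1.1 < q.2 ∧ q.2 ≤ a} (by measurability)
  convert h1.sub h2 using 1
  ext p
  simp only [Pi.sub_apply]
  rw [← integral_indicator measurableSet_Ioc, ← integral_indicator measurableSet_Ioc]
  rfl

end Joint

section Propagation

set_option linter.unusedSectionVars false

theorem uIoc_subset_uIoc_of_mem_uIcc {a b t : ℝ} (ht : t ∈ Set.uIcc a b) :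
    Set.uIoc a t ⊆ Set.uIoc a b :=
  Set.Ioc_subset_Ioc (le_min (min_le_left _ _) ht.1) (max_le (le_max_left _ _) ht.2)

variable {E V : Type*} [NormedAddCommGroup E] [InnerProductSpace ℝ E] [FiniteDimensional ℝ E]
  [MeasurableSpace E] [BorelSpace E] [NormedAddCommGroup V] [InnerProductSpace ℂ V]
  [CompleteSpace V]

/-- A solution of `y' = G y` on an interval is given by the exponential of `G`. -/
theorem eq_exp_smul_of_hasDerivAt {G : V →L[ℂ] V} {y : ℝ → V} {a b : ℝ}
    (hy : ∀ t ∈ Set.uIcc a b, HasDerivAt y (G (y t)) t) :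
    y b = NormedSpace.exp ((b - a) • G) (y a) := by
  have hexp : ∀ t : ℝ, HasDerivAt (fun s : ℝ => NormedSpace.exp ((b - s) • G))
      (-(NormedSpace.exp ((b - t) • G) * G)) t := by
    intro t
    have h1 := hasDerivAt_exp_smul_const (𝕂 := ℝ) G (b - t)
    have h2 : HasDerivAt (fun s : ℝ => b - s) (-1) t := by
      simpa using (hasDerivAt_id t).const_sub b
    rw [← neg_one_smul ℝ]
    exact h1.scomp t h2
  have hz : ∀ t ∈ Set.uIcc a b, HasDerivWithinAt
      (fun s => NormedSpace.exp ((b - s) • G) (y s)) 0 (Set.uIcc a b) t := by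
    intro t ht
    let Φ : (V →L[ℂ] V) →L[ℝ] V →L[ℝ] V :=
      (ContinuousLinearMap.restrictScalarsL ℂ V V ℝ ℝ)
    have h1 := (Φ.hasFDerivAt.comp_hasDerivAt t (hexp t)).clm_apply (hy t ht)
    have h2 : (Φ (-(NormedSpace.exp ((b - t) • G) * G))) (y t) +
        (Φ (NormedSpace.exp ((b - t) • G))) (G (y t)) = 0 := by
      simp [Φ]
    rw [← h2]
    exact h1.hasDerivWithinAt
  have := (convex_uIcc a b).norm_image_sub_le_of_norm_hasDerivWithin_le (C := 0) hz
    (by simp) Set.left_mem_uIcc Set.right_mem_uIcc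
  simpa [sub_eq_zero] using this

theorem eq_exp_smul_of_eq_add_integral {G : V →L[ℂ] V} {u v : ℝ → V} {a b : ℝ}
    (hi : IntegrableOn (fun t => G (u t)) (Set.uIoc a b))
    (hv : ∀ t ∈ Set.uIcc a b, v t = v a + ∫ s in a..t, G (u s))
    (huv : ∀ᵐ t, t ∈ Set.uIoc a b → u t = v t) :
    v b = NormedSpace.exp ((b - a) • G) (v a) := by
  have hii : IntervalIntegrable (fun t => G (u t)) volume a b :=
    intervalIntegrable_iff.2 hi
  have hvc : ContinuousOn v (Set.uIcc a b) :=
    (continuousOn_const.add (intervalIntegral.continuousOn_primitive_interval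
      (by rwa [Set.uIcc, integrableOn_Icc_iff_integrableOn_Ioc]))).congr hv
  obtain ⟨w, hw, hwv⟩ : ∃ w : ℝ → V, Continuous w ∧ ∀ t ∈ Set.uIcc a b, w t = v t :=
    ⟨fun t => v (Set.projIcc (min a b) (max a b) min_le_max t),
      hvc.comp_continuous (by fun_prop) fun t => Subtype.prop _, fun t ht => by
        simp only [Set.projIcc_of_mem min_le_max ht]⟩
  set y : ℝ → V := fun t => v a + ∫ s in a..t, G (w s) with hy
  have hyv : ∀ t ∈ Set.uIcc a b, y t = v t := by
    intro t ht
    rw [hv t ht, hy]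
    simp only [add_right_inj]
    refine intervalIntegral.integral_congr_ae ?_
    filter_upwards [huv] with s hs hst
    have hs' : s ∈ Set.uIoc a b := uIoc_subset_uIoc_of_mem_uIcc ht hst
    rw [hs hs', hwv s (Set.uIoc_subset_uIcc hs')]
  have := eq_exp_smul_of_hasDerivAt (G := G) (y := y) (a := a) (b := b) fun t ht => by
    rw [hyv t ht, ← hwv t ht]
    exact ((G.continuous.comp hw).integral_hasStrictDerivAt a t).hasDerivAt.const_add _
  rwa [hyv b Set.right_mem_uIcc, hyv a Set.left_mem_uIcc] at this

theorem ae_fourier_eq_exp_of_bounded {f g : ℝ → 𝓢(E, V)} {a b M : ℝ} {G : E → V →L[ℂ] V}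
    (hf : ∀ x, Continuous fun t => f t x) (hg : ∀ x, Continuous fun t => g t x)
    (hfg : ∀ t ∈ Set.uIcc a b, ∀ x, f t x = f a x + ∫ s in a..t, g s x)
    (hG : ∀ t ξ, 𝓕 (g t) ξ = G ξ (𝓕 (f t) ξ))
    (hM : ∀ t ∈ Set.uIoc a b, ∫ x, ‖g t x‖ ^ 2 ≤ M) :
    ∀ᵐ ξ, 𝓕 (f b) ξ = NormedSpace.exp ((b - a) • G ξ) (𝓕 (f a) ξ) := by
  have hmF := stronglyMeasurable_uncurry_fourier (stronglyMeasurable_uncurry_schwartz hf)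
  have hmG := stronglyMeasurable_uncurry_fourier (stronglyMeasurable_uncurry_schwartz hg)
  have hLG := memLp_two_uncurry (h := fun t => 𝓕 (g t)) hmG
    (fun t ht => (SchwartzMap.integral_norm_sq_fourier (g t)).trans_le (hM t ht))
  have hae : ∀ t ∈ Set.uIcc a b,
      ∀ᵐ ξ, 𝓕 (f t) ξ = 𝓕 (f a) ξ + ∫ s in a..t, 𝓕 (g s) ξ := fun t ht =>
    ae_fourier_eq_add_integral hg (hfg t ht) fun s hs =>
      hM s (uIoc_subset_uIoc_of_mem_uIcc ht hs)
  have hcomm : ∀ᵐ ξ : E, ∀ᵐ t : ℝ, t ∈ Set.uIoc a b →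
      𝓕 (f t) ξ = 𝓕 (f a) ξ + ∫ s in a..t, 𝓕 (g s) ξ := by
    refine (Measure.ae_ae_comm (p := fun (t : ℝ) (ξ : E) => t ∈ Set.uIoc a b →
      𝓕 (f t) ξ = 𝓕 (f a) ξ + ∫ s in a..t, 𝓕 (g s) ξ) ?_).1
      (Filter.Eventually.of_forall fun t => ?_)
    · have h1 : MeasurableSet {p : ℝ × E | 𝓕 (f p.1) p.2 =
          𝓕 (f a) p.2 + ∫ s in a..p.1, 𝓕 (g s) p.2} :=
        hmF.measurableSet_eq_fun (((𝓕 (f a)).continuous.stronglyMeasurable.comp_measurable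
          measurable_snd).add (stronglyMeasurable_intervalIntegral a hmG))
      have h2 : MeasurableSet {p : ℝ × E | p.1 ∈ Set.uIoc a b} :=
        measurable_fst measurableSet_uIoc
      exact h2.imp h1
    · by_cases ht : t ∈ Set.uIoc a b
      · filter_upwards [hae t (Set.uIoc_subset_uIcc ht)] with ξ hξ _ using hξ
      · exact Filter.Eventually.of_forall fun ξ h => absurd h ht
  filter_upwards [hcomm, hae b Set.right_mem_uIcc, ae_integrableOn_of_memLp_two hmG hLG]
    with ξ h1 h2 h3
  have := eq_exp_smul_of_eq_add_integral (G := G ξ) (u := fun t => 𝓕 (f t) ξ)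
    (v := fun t => 𝓕 (f a) ξ + ∫ s in a..t, 𝓕 (g s) ξ) (a := a) (b := b)
    (by simpa only [hG] using h3) (fun t _ => by simp [hG]) h1
  simpa [← h2] using this

theorem isClosed_setOf_integral_norm_sq_le {f g : ℝ → 𝓢(E, V)}
    (hf : ∀ x, Continuous fun t => f t x) (hg : ∀ x, Continuous fun t => g t x) (M : ℝ) :
    IsClosed {t | (∫ x, ‖f t x‖ ^ 2) + ∫ x, ‖g t x‖ ^ 2 ≤ M} := by
  have hsq : ∀ k : 𝓢(E, V), Integrable fun x => ‖k x‖ ^ 2 := fun k =>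
    (memLp_two_iff_integrable_sq_norm k.continuous.aestronglyMeasurable).1 (k.memLp 2)
  have hlin : ∀ t, ENNReal.ofReal ((∫ x, ‖f t x‖ ^ 2) + ∫ x, ‖g t x‖ ^ 2) =
      ∫⁻ x, ENNReal.ofReal (‖f t x‖ ^ 2 + ‖g t x‖ ^ 2) := fun t => by
    rw [← integral_add (hsq _) (hsq _)]
    exact ofReal_integral_eq_lintegral_ofReal
      ((hsq _).add (hsq _)) (Filter.Eventually.of_forall fun x => by positivity)
  refine IsSeqClosed.isClosed fun s t hs ht => ?_
  simp only [Set.mem_ofPred_eq] at hs ⊢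
  have hM : 0 ≤ M := le_trans (by positivity) (hs 0)
  rw [← ENNReal.ofReal_le_ofReal_iff hM, hlin]
  calc ∫⁻ x, ENNReal.ofReal (‖f t x‖ ^ 2 + ‖g t x‖ ^ 2)
      = ∫⁻ x, Filter.liminf (fun m => ENNReal.ofReal (‖f (s m) x‖ ^ 2 + ‖g (s m) x‖ ^ 2))
          Filter.atTop := by
        congr with x
        refine (Filter.Tendsto.liminf_eq ?_).symm
        have hc : Continuous fun r => ENNReal.ofReal (‖f r x‖ ^ 2 + ‖g r x‖ ^ 2) :=
          ENNReal.continuous_ofReal.comp (((hf x).norm.pow 2).add ((hg x).norm.pow 2))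
        exact (hc.tendsto t).comp ht
    _ ≤ Filter.liminf (fun m => ∫⁻ x, ENNReal.ofReal (‖f (s m) x‖ ^ 2 + ‖g (s m) x‖ ^ 2))
          Filter.atTop := lintegral_liminf_le fun m => by
        exact (ENNReal.continuous_ofReal.comp (((f (s m)).continuous.norm.pow 2).add
          ((g (s m)).continuous.norm.pow 2))).measurable
    _ ≤ ENNReal.ofReal M := by
        refine (Filter.liminf_le_liminf (v := fun _ => ENNReal.ofReal M)
          (Filter.Eventually.of_forall fun m => ?_)).trans_eq (Filter.liminf_const _)
        rw [← hlin]
        exact ENNReal.ofReal_le_ofReal (hs m)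

/-- Pointwise time-differentiable Schwartz-valued solutions of an evolution equation with Fourier
symbol `G` are given by the propagator `exp (t G)`, without any uniformity in time being assumed. -/
theorem ae_fourier_eq_exp {f g : ℝ → 𝓢(E, V)} {G : E → V →L[ℂ] V} {D c : ℝ}
    (hD : 0 ≤ D) (hc : 0 ≤ c)
    (hf : ∀ x, Continuous fun t => f t x) (hg : ∀ x, Continuous fun t => g t x)
    (hfg : ∀ s t, 0 ≤ s → 0 ≤ t → ∀ x, f t x = f s x + ∫ r in s..t, g r x)
    (hG : ∀ t ξ, 𝓕 (g t) ξ = G ξ (𝓕 (f t) ξ))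
    (hexp : ∀ (ξ : E) (t : ℝ) (z : V),
      ‖NormedSpace.exp (t • G ξ) z‖ ^ 2 ≤ D * Real.exp (c * |t|) * ‖z‖ ^ 2)
    {t : ℝ} (ht : 0 ≤ t) :
    ∀ᵐ ξ, 𝓕 (f t) ξ = NormedSpace.exp (t • G ξ) (𝓕 (f 0) ξ) := by
  have hsq : ∀ k : 𝓢(E, V), Integrable fun x => ‖k x‖ ^ 2 := fun k =>
    (memLp_two_iff_integrable_sq_norm k.continuous.aestronglyMeasurable).1 (k.memLp 2)
  set N₀ : ℝ → ℝ := fun t => (∫ x, ‖f t x‖ ^ 2) + ∫ x, ‖g t x‖ ^ 2 with hN₀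
  have hN₀nonneg : ∀ t, 0 ≤ N₀ t := fun t => by simp only [hN₀]; positivity
  have hgN : ∀ t, ∫ x, ‖g t x‖ ^ 2 ≤ N₀ t := fun t =>
    le_add_of_nonneg_left (by positivity)
  have huIcc : ∀ {a b s : ℝ}, 0 ≤ a → 0 ≤ b → s ∈ Set.uIcc a b → 0 ≤ s := fun ha hb hs =>
    (le_min ha hb).trans hs.1
  have hsol : ∀ a b M, 0 ≤ a → 0 ≤ b → (∀ s ∈ Set.uIcc a b, N₀ s ≤ M) →
      ∀ᵐ ξ, 𝓕 (f b) ξ = NormedSpace.exp ((b - a) • G ξ) (𝓕 (f a) ξ) := by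
    intro a b M ha hb hM
    exact ae_fourier_eq_exp_of_bounded hf hg
      (fun s hs => hfg a s ha (huIcc ha hb hs)) hG
      fun s hs => (hgN s).trans (hM s (Set.uIoc_subset_uIcc hs))
  have hle : ∀ a b M, 0 ≤ a → 0 ≤ b → (∀ s ∈ Set.uIcc a b, N₀ s ≤ M) →
      N₀ b ≤ D * Real.exp (c * |b - a|) * N₀ a := by
    intro a b M ha hb hM
    have h1 := hsol a b M ha hb hM
    simp only [hN₀]
    rw [mul_add, ← SchwartzMap.integral_norm_sq_fourier (f b),
      ← SchwartzMap.integral_norm_sq_fourier (g b), ← SchwartzMap.integral_norm_sq_fourier (f a),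
      ← SchwartzMap.integral_norm_sq_fourier (g a), ← integral_const_mul, ← integral_const_mul]
    refine add_le_add ?_ ?_
    · refine integral_mono_ae (hsq _) ((hsq _).const_mul _) ?_
      filter_upwards [h1] with ξ hξ
      rw [hξ]
      exact hexp _ _ _
    · refine integral_mono_ae (hsq _) ((hsq _).const_mul _) ?_
      filter_upwards [h1] with ξ hξ
      have hcomm : Commute (G ξ) (NormedSpace.exp ((b - a) • G ξ)) :=
        ((Commute.refl (G ξ)).smul_right (b - a)).exp_right
      have : G ξ (NormedSpace.exp ((b - a) • G ξ) (𝓕 (f a) ξ)) =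
          NormedSpace.exp ((b - a) • G ξ) (G ξ (𝓕 (f a) ξ)) :=
        congrArg (fun T : V →L[ℂ] V => T (𝓕 (f a) ξ)) hcomm.eq
      rw [hG, hξ, this, ← hG a]
      exact hexp _ _ _
  have hbdd := bddAbove_image_uIcc_of_propagation (N := fun t => N₀ (max t 0)) hD hc
    (fun t => hN₀nonneg _)
    (fun M => (isClosed_setOf_integral_norm_sq_le hf hg M).preimage
      (f := fun t : ℝ => max t 0) (by fun_prop))
    (fun a b ⟨M, hM⟩ => by
      refine (hle (max a 0) (max b 0) M (le_max_right _ _) (le_max_right _ _)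
        fun s hs => ?_).trans ?_
      · obtain ⟨r, hr, rfl⟩ := intermediate_value_uIcc (f := fun t : ℝ => max t 0)
          (a := a) (b := b) (by fun_prop) hs
        exact hM ⟨r, hr, rfl⟩
      · have := hN₀nonneg (max a 0)
        have := abs_max_sub_max_le_abs b a 0
        gcongr) 0 t
  obtain ⟨M, hM⟩ := hbdd
  have := hsol 0 t M le_rfl ht fun s hs => by
    have : N₀ (max s 0) ≤ M := hM ⟨s, hs, rfl⟩
    rwa [max_eq_left (huIcc le_rfl ht hs)] at this
  simpa using this

end Propagation

section Lyapunov

variable {V : Type*} [NormedAddCommGroup V] [InnerProductSpace ℂ V] [CompleteSpace V]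

/-- Grönwall's inequality for a quadratic functional along a linear flow. -/
theorem re_inner_exp_smul_le {S G : V →L[ℂ] V} {c : ℝ}
    (hS : ∀ x y, (inner ℂ (S x) y).re = (inner ℂ (S y) x).re)
    (hd : ∀ z, 2 * (inner ℂ (S (G z)) z).re ≤ -c * (inner ℂ (S z) z).re)
    {t : ℝ} (ht : 0 ≤ t) (z : V) :
    (inner ℂ (S (NormedSpace.exp (t • G) z)) (NormedSpace.exp (t • G) z)).re ≤
      Real.exp (-c * t) * (inner ℂ (S z) z).re := by
  set y : ℝ → V := fun s => NormedSpace.exp (s • G) z with hy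
  let R : (V →L[ℂ] V) →L[ℝ] V →L[ℝ] V := ContinuousLinearMap.restrictScalarsL ℂ V V ℝ ℝ
  have hyd : ∀ s, HasDerivAt y (G (y s)) s := by
    intro s
    have h1 : HasDerivAt (fun u : ℝ => NormedSpace.exp (u • G))
        (G * NormedSpace.exp (s • G)) s := hasDerivAt_exp_smul_const' (𝕂 := ℝ) G s
    have h2 := (R.hasFDerivAt.comp_hasDerivAt s h1).clm_apply (hasDerivAt_const s z)
    simpa [R] using h2
  have hΦ : ∀ s, HasDerivAt (fun u => (inner ℂ (S (y u)) (y u)).re)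
      (2 * (inner ℂ (S (G (y s))) (y s)).re) s := by
    intro s
    have h1 : HasDerivAt (fun u => S (y u)) (S (G (y s))) s :=
      (R S).hasFDerivAt.comp_hasDerivAt s (hyd s)
    have h2 := Complex.reCLM.hasFDerivAt.comp_hasDerivAt s (h1.inner ℂ (hyd s))
    convert! h2 using 1
    simp only [Complex.reCLM_apply, Complex.add_re]
    rw [hS (y s)]
    ring
  have hmono : Antitone fun s => Real.exp (c * s) * (inner ℂ (S (y s)) (y s)).re := by
    have hder : ∀ s, HasDerivAt (fun s => Real.exp (c * s) * (inner ℂ (S (y s)) (y s)).re)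
        (Real.exp (c * s) * c * (inner ℂ (S (y s)) (y s)).re +
          Real.exp (c * s) * (2 * (inner ℂ (S (G (y s))) (y s)).re)) s := fun s => by
      have : HasDerivAt (fun s => c * s) c s := by simpa using (hasDerivAt_id s).const_mul c
      exact this.exp.mul (hΦ s)
    refine antitone_of_deriv_nonpos (fun s => (hder s).differentiableAt) fun s => ?_
    rw [(hder s).deriv]
    have := mul_le_mul_of_nonneg_left (hd (y s)) (Real.exp_pos (c * s)).le
    linarith
  have h0 := hmono ht
  simp only [mul_zero, Real.exp_zero, one_mul] at h0
  have hy0 : y 0 = z := by simp [hy]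
  rw [hy0] at h0
  calc (inner ℂ (S (y t)) (y t)).re
      = Real.exp (-c * t) * (Real.exp (c * t) * (inner ℂ (S (y t)) (y t)).re) := by
        rw [← mul_assoc, ← Real.exp_add]; simp
    _ ≤ _ := by gcongr

/-- Growth bound, in both time directions, for the flow of `G` when the energy given by `a₀`
changes at a controlled rate. -/
theorem norm_sq_exp_smul_le_of_energy {a₀ G : V →L[ℂ] V} {m M Λ : ℝ} (hm : 0 < m)
    (ha₀ : ∀ x y, (inner ℂ (a₀ x) y).re = (inner ℂ (a₀ y) x).re)
    (hlow : ∀ z, m * ‖z‖ ^ 2 ≤ (inner ℂ (a₀ z) z).re)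
    (hup : ∀ z, (inner ℂ (a₀ z) z).re ≤ M * ‖z‖ ^ 2)
    (hG : ∀ z, |(inner ℂ (a₀ (G z)) z).re| ≤ Λ * ‖z‖ ^ 2) (hΛ : 0 ≤ Λ) (t : ℝ) (z : V) :
    ‖NormedSpace.exp (t • G) z‖ ^ 2 ≤ M / m * Real.exp (2 * Λ / m * |t|) * ‖z‖ ^ 2 := by
  have key : ∀ H : V →L[ℂ] V, (∀ z, |(inner ℂ (a₀ (H z)) z).re| ≤ Λ * ‖z‖ ^ 2) →
      ∀ s : ℝ, 0 ≤ s → ‖NormedSpace.exp (s • H) z‖ ^ 2 ≤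
        M / m * Real.exp (2 * Λ / m * s) * ‖z‖ ^ 2 := by
    intro H hH s hs
    have h1 := re_inner_exp_smul_le (S := a₀) (G := H) (c := -(2 * Λ / m)) ha₀ (fun z => by
      have h2 : 2 * Λ / m * (m * ‖z‖ ^ 2) ≤ 2 * Λ / m * (inner ℂ (a₀ z) z).re := by
        gcongr
        exact hlow z
      have h3 : 2 * Λ / m * (m * ‖z‖ ^ 2) = 2 * (Λ * ‖z‖ ^ 2) := by field_simp
      have := (abs_le.1 (hH z)).2
      linarith) hs z
    have h2 := (hlow (NormedSpace.exp (s • H) z)).trans (h1.trans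
      (mul_le_mul_of_nonneg_left (hup z) (Real.exp_pos _).le))
    rw [neg_neg] at h2
    rw [div_mul_eq_mul_div, div_mul_eq_mul_div, le_div_iff₀ hm]
    linarith
  rcases le_total 0 t with ht | ht
  · rw [abs_of_nonneg ht]
    exact key G hG t ht
  · rw [abs_of_nonpos ht]
    have := key (-G) (fun z => by simpa using hG z) (-t) (by linarith)
    simpa using this

/-- Kawashima's compensated energy estimate: uniform decay of `exp (t G)` for
`a₀ G = -(i η a + l)` in the presence of a compensating operator `k`. -/
theorem exists_norm_sq_exp_smul_le (m M Λ κ B : ℝ) (hm : 0 < m) (hM : 0 < M) (hΛ : 0 ≤ Λ)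
    (hκ : 0 < κ) (hB : 0 ≤ B) :
    ∃ D c : ℝ, 0 < D ∧ 0 < c ∧ ∀ (a₀ a l k G : V →L[ℂ] V) (η : ℝ), 0 ≤ η →
      (∀ x y, (inner ℂ (a₀ x) y).re = (inner ℂ (a₀ y) x).re) →
      (∀ z, m * ‖z‖ ^ 2 ≤ (inner ℂ (a₀ z) z).re) →
      (∀ z, ‖a₀ z‖ ≤ M * ‖z‖) →
      (∀ z, (inner ℂ (a z) z).im = 0) →
      (∀ z, ‖l z‖ ^ 2 ≤ Λ * (inner ℂ (l z) z).re) →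
      (∀ z, 0 ≤ (inner ℂ (l z) z).re) →
      (∀ x y, inner ℂ (k (a₀ x)) y = -inner ℂ x (k (a₀ y))) →
      (∀ z, κ * ‖z‖ ^ 2 ≤ (inner ℂ (k (a z)) z).re + (inner ℂ (l z) z).re) →
      (∀ z, ‖k z‖ ≤ B * ‖z‖) →
      (∀ z, a₀ (G z) = -((Complex.I * η) • a z + l z)) →
      ∀ t : ℝ, 0 ≤ t → ∀ z, ‖NormedSpace.exp (t • G) z‖ ^ 2 ≤
        D * Real.exp (-c * (η ^ 2 / (1 + η ^ 2)) * t) * ‖z‖ ^ 2 := by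
  obtain ⟨ε, hε, hε1, hεm, hεκ⟩ : ∃ ε : ℝ, 0 < ε ∧ ε ≤ 1 ∧ ε * (B * M) ≤ m / 2 ∧
      ε * (2 + B ^ 2 * Λ / κ) ≤ 2 := by
    refine ⟨min 1 (min (m / 2 / (B * M + 1)) (2 / (2 + B ^ 2 * Λ / κ))), by positivity,
      min_le_left _ _, ?_, ?_⟩
    · calc _ ≤ m / 2 / (B * M + 1) * (B * M + 1) := by
            gcongr
            · exact (min_le_right _ _).trans (min_le_left _ _)
            · linarith
        _ = m / 2 := by field_simp
    · calc _ ≤ 2 / (2 + B ^ 2 * Λ / κ) * (2 + B ^ 2 * Λ / κ) := by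
            gcongr
            exact (min_le_right _ _).trans (min_le_right _ _)
        _ = 2 := by field_simp
  refine ⟨2 * (M * (1 + B)) / m, ε * κ / (M * (1 + B)), by positivity, by positivity, ?_⟩
  intro a₀ a l k G η hη ha₀ hlow hup ha hl hl0 hk hκl hkB hG t ht z
  set σ : ℝ := η / (1 + η ^ 2) with hσ
  set r : ℝ := η ^ 2 / (1 + η ^ 2) with hr
  have hσ0 : 0 ≤ σ := by positivity
  have hr0 : 0 ≤ r := by positivity
  have hr1 : r ≤ 1 := by rw [hr, div_le_one (by positivity)]; linarith
  have hσ1 : σ ≤ 1 := by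
    rw [hσ, div_le_one (by positivity)]; nlinarith [sq_nonneg (η - 1)]
  have hση : σ * η = r := by rw [hσ, hr]; ring
  have hσr : σ ^ 2 ≤ r := by
    rw [hσ, hr, div_pow, div_le_div_iff₀ (by positivity) (by positivity)]
    nlinarith [mul_nonneg (sq_nonneg η) (sq_nonneg η),
      mul_nonneg (mul_nonneg (sq_nonneg η) (sq_nonneg η)) (sq_nonneg η)]
  set S : V →L[ℂ] V := a₀ - ((ε * σ : ℝ) * Complex.I : ℂ) • (k ∘L a₀) with hSdef
  have hSz : ∀ x y, (inner ℂ (S x) y).re =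
      (inner ℂ (a₀ x) y).re - ε * σ * (inner ℂ (k (a₀ x)) y).im := by
    intro x y
    simp only [hSdef, _root_.sub_apply, _root_.smul_apply,
      ContinuousLinearMap.comp_apply, inner_sub_left, inner_smul_left]
    simp
    ring
  have hkim : ∀ z, |(inner ℂ (k (a₀ z)) z).im| ≤ B * M * ‖z‖ ^ 2 := fun z =>
    calc |(inner ℂ (k (a₀ z)) z).im| ≤ ‖inner ℂ (k (a₀ z)) z‖ := Complex.abs_im_le_norm _
      _ ≤ ‖k (a₀ z)‖ * ‖z‖ := norm_inner_le_norm _ _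
      _ ≤ B * (M * ‖z‖) * ‖z‖ := by
          gcongr
          exact (hkB _).trans (by gcongr; exact hup z)
      _ = B * M * ‖z‖ ^ 2 := by ring
  have hεσ : ε * σ ≤ ε := mul_le_of_le_one_right hε.le hσ1
  have hkimσ : ∀ z, |ε * σ * (inner ℂ (k (a₀ z)) z).im| ≤ ε * (B * M) * ‖z‖ ^ 2 := fun z => by
    rw [abs_mul, abs_of_nonneg (by positivity)]
    calc _ ≤ ε * (B * M * ‖z‖ ^ 2) := by gcongr; exact hkim z
      _ = _ := by ring
  have hSlow : ∀ z, m / 2 * ‖z‖ ^ 2 ≤ (inner ℂ (S z) z).re := fun z => by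
    rw [hSz]
    have h1 := (abs_le.1 (hkimσ z)).2
    have h2 := mul_le_mul_of_nonneg_right hεm (sq_nonneg ‖z‖)
    have := hlow z
    linarith
  have hSup : ∀ z, (inner ℂ (S z) z).re ≤ M * (1 + B) * ‖z‖ ^ 2 := fun z => by
    rw [hSz]
    have h1 := (abs_le.1 (hkimσ z)).1
    have h2 : ε * (B * M) * ‖z‖ ^ 2 ≤ 1 * (B * M) * ‖z‖ ^ 2 := by gcongr
    have h3 : (inner ℂ (a₀ z) z).re ≤ M * ‖z‖ ^ 2 :=
      calc _ ≤ ‖inner ℂ (a₀ z) z‖ := Complex.re_le_norm _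
        _ ≤ ‖a₀ z‖ * ‖z‖ := norm_inner_le_norm _ _
        _ ≤ M * ‖z‖ * ‖z‖ := by gcongr; exact hup z
        _ = _ := by ring
    linarith
  have hSsymm : ∀ x y, (inner ℂ (S x) y).re = (inner ℂ (S y) x).re := by
    intro x y
    rw [hSz, hSz, ha₀, hk x y, ← inner_conj_symm x, Complex.neg_im, Complex.conj_im, neg_neg]
  have hdiss : ∀ z, 2 * (inner ℂ (S (G z)) z).re ≤
      -(ε * κ / (M * (1 + B)) * r) * (inner ℂ (S z) z).re := by
    intro z
    have e1 : (inner ℂ (a₀ (G z)) z).re = -(inner ℂ (l z) z).re := by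
      rw [hG, inner_neg_left, inner_add_left, inner_smul_left]
      simp [ha]
    have e2 : (inner ℂ (k (a₀ (G z))) z).im =
        η * (inner ℂ (k (a z)) z).re - (inner ℂ (k (l z)) z).im := by
      rw [hG, map_neg, map_add, map_smul, inner_neg_left, inner_add_left, inner_smul_left]
      simp
      ring
    have hβ : |(inner ℂ (k (l z)) z).im| ≤ B * ‖l z‖ * ‖z‖ :=
      calc _ ≤ ‖inner ℂ (k (l z)) z‖ := Complex.abs_im_le_norm _
        _ ≤ ‖k (l z)‖ * ‖z‖ := norm_inner_le_norm _ _
        _ ≤ _ := by gcongr; exact hkB _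
    rw [hSz, e1, e2]
    set q := (inner ℂ (l z) z).re
    set α := (inner ℂ (k (a z)) z).re
    set β := (inner ℂ (k (l z)) z).im
    have hq : 0 ≤ q := hl0 z
    have hlz := hl z
    have hκz : κ * ‖z‖ ^ 2 ≤ α + q := hκl z
    have hcross : 2 * (σ * β) ≤ κ * (r * ‖z‖ ^ 2) + B ^ 2 * Λ / κ * q := by
      have h1 : σ * β ≤ (σ * ‖z‖) * (B * ‖l z‖) := by
        calc σ * β ≤ σ * (B * ‖l z‖ * ‖z‖) := by gcongr; exact (abs_le.1 hβ).2
          _ = _ := by ring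
      have h2 : 2 * ((σ * ‖z‖) * (B * ‖l z‖)) ≤
          κ * (σ * ‖z‖) ^ 2 + (B * ‖l z‖) ^ 2 / κ := by
        have : κ * (σ * ‖z‖) ^ 2 + (B * ‖l z‖) ^ 2 / κ - 2 * ((σ * ‖z‖) * (B * ‖l z‖)) =
            (κ * (σ * ‖z‖) - B * ‖l z‖) ^ 2 / κ := by field_simp; ring
        have h3 : 0 ≤ (κ * (σ * ‖z‖) - B * ‖l z‖) ^ 2 / κ := by positivity
        linarith
      have h3 : κ * (σ * ‖z‖) ^ 2 ≤ κ * (r * ‖z‖ ^ 2) := by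
        rw [mul_pow]; gcongr
      have h4 : (B * ‖l z‖) ^ 2 / κ ≤ B ^ 2 * Λ / κ * q := by
        rw [mul_pow, div_mul_eq_mul_div, mul_assoc]
        gcongr
      linarith
    have hΦ : ε * κ / (M * (1 + B)) * r * (inner ℂ (S z) z).re ≤ ε * κ * (r * ‖z‖ ^ 2) := by
      calc _ ≤ ε * κ / (M * (1 + B)) * r * (M * (1 + B) * ‖z‖ ^ 2) := by
            gcongr; exact hSup z
        _ = _ := by field_simp
    have h5 : ε * (2 * (σ * β)) ≤ ε * (κ * (r * ‖z‖ ^ 2) + B ^ 2 * Λ / κ * q) := by gcongr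
    have h6 : ε * r * (κ * ‖z‖ ^ 2) ≤ ε * r * (α + q) := by gcongr
    have h7 : ε * (2 + B ^ 2 * Λ / κ) * q ≤ 2 * q := by gcongr
    have h8 : ε * r * q ≤ ε * 1 * q := by gcongr
    have e3 : 2 * (-q - ε * σ * (η * α - β)) = -2 * q - 2 * (ε * r * α) + ε * (2 * (σ * β)) := by
      rw [← hση]; ring
    rw [e3]
    linarith
  have h1 := re_inner_exp_smul_le hSsymm hdiss ht z
  have h2 := (hSlow _).trans (h1.trans (mul_le_mul_of_nonneg_left (hSup z) (Real.exp_pos _).le))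
  rw [div_mul_eq_mul_div, div_mul_eq_mul_div, le_div_iff₀ hm]
  simp only [← neg_mul] at h2
  linarith

end Lyapunov

section MatrixSymbol

variable {N : ℕ}

/-- A real matrix acting on complex vectors, as an `ℝ`-algebra homomorphism. -/
noncomputable def complexAction (N : ℕ) : Matrix (Fin N) (Fin N) ℝ →ₐ[ℝ]
    (EuclideanSpace ℂ (Fin N) →L[ℂ] EuclideanSpace ℂ (Fin N)) :=
  ((Matrix.toEuclideanCLM (n := Fin N) (𝕜 := ℂ)).toAlgEquiv.toAlgHom.restrictScalars ℝ).comp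
    Complex.ofRealAm.mapMatrix

theorem complexAction_apply (M : Matrix (Fin N) (Fin N) ℝ) (z : EuclideanSpace ℂ (Fin N))
    (i : Fin N) : complexAction N M z i = ∑ j, (M i j : ℂ) * z j := by
  simp [complexAction, Matrix.mulVec, dotProduct]

theorem continuous_complexAction : Continuous (complexAction N) :=
  (complexAction N).toLinearMap.continuous_of_finiteDimensional

theorem inner_complexAction_left (M : Matrix (Fin N) (Fin N) ℝ) (x y : EuclideanSpace ℂ (Fin N)) :
    inner ℂ (complexAction N M x) y = inner ℂ x (complexAction N Mᵀ y) := by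
  simp only [PiLp.inner_apply, complexAction_apply, RCLike.inner_apply, map_sum, map_mul,
    Finset.mul_sum, Finset.sum_mul, Matrix.transpose_apply]
  rw [Finset.sum_comm]
  refine Finset.sum_congr rfl fun i _ => Finset.sum_congr rfl fun j _ => ?_
  simp [mul_left_comm, mul_assoc]

theorem re_inner_complexAction (M : Matrix (Fin N) (Fin N) ℝ) (z : EuclideanSpace ℂ (Fin N)) :
    (inner ℂ (complexAction N M z) z).re =
      (fun i => (z i).re) ⬝ᵥ M *ᵥ (fun i => (z i).re) +
        (fun i => (z i).im) ⬝ᵥ M *ᵥ (fun i => (z i).im) := by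
  simp only [PiLp.inner_apply, complexAction_apply, RCLike.inner_apply, map_sum, map_mul,
    Matrix.mulVec, dotProduct, Finset.mul_sum, ← Finset.sum_add_distrib, Complex.re_sum]
  refine Finset.sum_congr rfl fun i _ => Finset.sum_congr rfl fun j _ => ?_
  simp

theorem re_inner_complexAction_pos {M : Matrix (Fin N) (Fin N) ℝ} (hM : M.PosDef)
    {z : EuclideanSpace ℂ (Fin N)} (hz : z ≠ 0) : 0 < (inner ℂ (complexAction N M z) z).re := by
  rw [re_inner_complexAction]
  have hn : ∀ x : Fin N → ℝ, 0 ≤ x ⬝ᵥ M *ᵥ x := fun x => by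
    simpa using hM.posSemidef.dotProduct_mulVec_nonneg x
  have hp : ∀ x : Fin N → ℝ, x ≠ 0 → 0 < x ⬝ᵥ M *ᵥ x := fun x hx => by
    simpa using hM.dotProduct_mulVec_pos hx
  by_cases hre : (fun i => (z i).re) = 0
  · refine add_pos_of_nonneg_of_pos (hn _) (hp _ fun him => hz ?_)
    ext i
    exact Complex.ext (congrFun hre i) (congrFun him i)
  · exact add_pos_of_pos_of_nonneg (hp _ hre) (hn _)

theorem re_inner_complexAction_symPart (M : Matrix (Fin N) (Fin N) ℝ)
    (z : EuclideanSpace ℂ (Fin N)) :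
    (inner ℂ (complexAction N (symPart M) z) z).re = (inner ℂ (complexAction N M z) z).re := by
  have h : (inner ℂ (complexAction N Mᵀ z) z).re = (inner ℂ (complexAction N M z) z).re := by
    rw [inner_complexAction_left, Matrix.transpose_transpose, ← inner_conj_symm, Complex.conj_re]
  rw [symPart, map_smul, map_add, _root_.smul_apply, _root_.add_apply, inner_smul_left_eq_smul,
    inner_add_left, Complex.smul_re, Complex.add_re, h, smul_eq_mul]
  ring

theorem exists_norm_sq_complexAction_le {L : Matrix (Fin N) (Fin N) ℝ} (hL : L.PosSemidef) :
    ∃ Λ : ℝ, 0 ≤ Λ ∧ ∀ z, 0 ≤ (inner ℂ (complexAction N L z) z).re ∧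
      ‖complexAction N L z‖ ^ 2 ≤ Λ * (inner ℂ (complexAction N L z) z).re := by
  obtain ⟨S, rfl⟩ : ∃ S : Matrix (Fin N) (Fin N) ℝ, L = Sᵀ * S := by
    open scoped MatrixOrder in
    obtain ⟨S, hS⟩ := CStarAlgebra.nonneg_iff_eq_star_mul_self.1 hL.nonneg
    exact ⟨S, by rw [hS, Matrix.star_eq_conjTranspose, Matrix.conjTranspose_eq_transpose_of_trivial]⟩
  have h : ∀ z, (inner ℂ (complexAction N (Sᵀ * S) z) z).re = ‖complexAction N S z‖ ^ 2 := by
    intro z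
    rw [map_mul, mul_apply_eq_comp, inner_complexAction_left,
      Matrix.transpose_transpose, inner_self_eq_norm_sq_to_K]
    norm_cast
  refine ⟨‖complexAction N Sᵀ‖ ^ 2, by positivity, fun z => ?_⟩
  rw [h, ← mul_pow, map_mul, mul_apply_eq_comp]
  exact ⟨by positivity, by gcongr; exact ContinuousLinearMap.le_opNorm _ _⟩

/-- A continuous family of coercive operators over a compact set is uniformly coercive. -/
theorem exists_pos_mul_norm_sq_le_re_inner {X : Type*} [TopologicalSpace X] {s : Set X}
    (hs : IsCompact s) {F : X → EuclideanSpace ℂ (Fin N) →L[ℂ] EuclideanSpace ℂ (Fin N)}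
    (hF : ContinuousOn F s) (hpos : ∀ ω ∈ s, ∀ z, z ≠ 0 → 0 < (inner ℂ (F ω z) z).re) :
    ∃ κ : ℝ, 0 < κ ∧ ∀ ω ∈ s, ∀ z, κ * ‖z‖ ^ 2 ≤ (inner ℂ (F ω z) z).re := by
  set u : Set (EuclideanSpace ℂ (Fin N)) := Metric.sphere 0 1
  have hc : IsCompact (s ×ˢ u) := hs.prod (isCompact_sphere _ _)
  have hcont : ContinuousOn (fun q : X × EuclideanSpace ℂ (Fin N) => (inner ℂ (F q.1 q.2) q.2).re)
      (s ×ˢ u) := by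
    refine Complex.continuous_re.comp_continuousOn (ContinuousOn.inner ?_ continuousOn_snd)
    exact (hF.comp continuousOn_fst fun q hq => hq.1).clm_apply continuousOn_snd
  obtain ⟨κ, hκ, h⟩ : ∃ κ : ℝ, 0 < κ ∧ ∀ q ∈ s ×ˢ u, κ ≤ (inner ℂ (F q.1 q.2) q.2).re := by
    rcases (s ×ˢ u).eq_empty_or_nonempty with he | hne
    · exact ⟨1, one_pos, by simp [he]⟩
    · obtain ⟨q, hq, hmin⟩ := hc.exists_isMinOn hne hcont
      refine ⟨_, hpos q.1 hq.1 q.2 ?_, hmin⟩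
      rintro h0
      have := hq.2
      simp [u, h0] at this
  refine ⟨κ, hκ, fun ω hω z => ?_⟩
  by_cases hz : z = 0
  · simp [hz]
  have hz' : 0 < ‖z‖ := norm_pos_iff.2 hz
  have h1 := h (ω, ((‖z‖⁻¹ : ℝ) : ℂ) • z) ⟨hω, by
    simp [u, norm_smul, hz'.ne']⟩
  simp only [map_smul, inner_smul_left, inner_smul_right, Complex.conj_ofReal,
    Complex.re_ofReal_mul] at h1
  calc κ * ‖z‖ ^ 2 ≤ (‖z‖⁻¹ * (‖z‖⁻¹ * (inner ℂ (F ω z) z).re)) * ‖z‖ ^ 2 := by gcongr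
    _ = _ := by field_simp

variable {n : ℕ}

/-- The Fourier symbol of the spatial operator, solved for the time derivative. -/
noncomputable def hyperbolicSymbol (A0 : Matrix (Fin N) (Fin N) ℝ)
    (A : Fin n → Matrix (Fin N) (Fin N) ℝ) (L : Matrix (Fin N) (Fin N) ℝ)
    (ξ : EuclideanSpace ℝ (Fin n)) : EuclideanSpace ℂ (Fin N) →L[ℂ] EuclideanSpace ℂ (Fin N) :=
  -(complexAction N A0⁻¹ * ((2 * Real.pi * Complex.I : ℂ) • complexAction N (∑ j, ξ j • A j) +
    complexAction N L))

theorem exists_norm_sq_exp_hyperbolicSymbol_le (hn : 1 ≤ n)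
    (A0 : Matrix (Fin N) (Fin N) ℝ) (A : Fin n → Matrix (Fin N) (Fin N) ℝ)
    (L : Matrix (Fin N) (Fin N) ℝ)
    (hA0 : A0.PosDef) (hA0s : A0.IsSymm) (hA : ∀ j, (A j).IsSymm) (hL : L.PosSemidef)
    (K : EuclideanSpace ℝ (Fin n) → Matrix (Fin N) (Fin N) ℝ)
    (hKcont : ContinuousOn K (Metric.sphere (0 : EuclideanSpace ℝ (Fin n)) 1))
    (hKskew : ∀ ω ∈ Metric.sphere (0 : EuclideanSpace ℝ (Fin n)) 1,
      (K ω * A0).transpose = -(K ω * A0))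
    (hKA : ∀ ω ∈ Metric.sphere (0 : EuclideanSpace ℝ (Fin n)) 1,
      (symPart (K ω * ∑ j, ω j • A j) + L).PosDef) :
    ∃ D c D' c' : ℝ, 0 < D ∧ 0 < c ∧ 0 ≤ D' ∧ 0 ≤ c' ∧
      (∀ ξ, ∀ t : ℝ, 0 ≤ t → ∀ z, ‖NormedSpace.exp (t • hyperbolicSymbol A0 A L ξ) z‖ ^ 2 ≤
        D * Real.exp (-c * (‖ξ‖ ^ 2 / (1 + ‖ξ‖ ^ 2)) * t) * ‖z‖ ^ 2) ∧
      ∀ ξ, ∀ t : ℝ, ∀ z, ‖NormedSpace.exp (t • hyperbolicSymbol A0 A L ξ) z‖ ^ 2 ≤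
        D' * Real.exp (c' * |t|) * ‖z‖ ^ 2 := by
  have hsymm : ∀ {M : Matrix (Fin N) (Fin N) ℝ}, M.IsSymm → ∀ x y,
      inner ℂ (complexAction N M x) y = inner ℂ x (complexAction N M y) := fun hM x y => by
    rw [inner_complexAction_left, hM.eq]
  have hsymm_re : ∀ {M : Matrix (Fin N) (Fin N) ℝ}, M.IsSymm → ∀ x y,
      (inner ℂ (complexAction N M x) y).re = (inner ℂ (complexAction N M y) x).re :=
    fun hM x y => by rw [hsymm hM, ← inner_conj_symm, Complex.conj_re]
  have hsymm_im : ∀ {M : Matrix (Fin N) (Fin N) ℝ}, M.IsSymm → ∀ z,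
      (inner ℂ (complexAction N M z) z).im = 0 := fun {M} hM z => by
    have := congrArg Complex.im (inner_conj_symm (𝕜 := ℂ) (complexAction N M z) z)
    rw [← hsymm hM, Complex.conj_im] at this
    linarith
  obtain ⟨m, hm, hlow⟩ : ∃ m : ℝ, 0 < m ∧
      ∀ z, m * ‖z‖ ^ 2 ≤ (inner ℂ (complexAction N A0 z) z).re := by
    obtain ⟨m, hm, h⟩ := exists_pos_mul_norm_sq_le_re_inner (isCompact_univ (X := Unit))
      (F := fun _ => complexAction N A0) continuousOn_const
      fun _ _ _ hz => re_inner_complexAction_pos hA0 hz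
    exact ⟨m, hm, h () trivial⟩
  obtain ⟨Λ, hΛ, hl⟩ := exists_norm_sq_complexAction_le hL
  have hcA : Continuous fun ω : EuclideanSpace ℝ (Fin n) => ∑ j, ω j • A j := by fun_prop
  obtain ⟨κ, hκ, hcoer⟩ := exists_pos_mul_norm_sq_le_re_inner
    (isCompact_sphere (0 : EuclideanSpace ℝ (Fin n)) 1)
    (F := fun ω => complexAction N (K ω * ∑ j, ω j • A j) + complexAction N L)
    ((continuous_complexAction.comp_continuousOn (hKcont.mul hcA.continuousOn)).add
      continuousOn_const) (fun ω hω z hz => by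
        have := re_inner_complexAction_pos (hKA ω hω) hz
        rwa [map_add, _root_.add_apply, inner_add_left, Complex.add_re,
          re_inner_complexAction_symPart, ← Complex.add_re, ← inner_add_left] at this)
  obtain ⟨B, hB⟩ := (isCompact_sphere (0 : EuclideanSpace ℝ (Fin n)) 1).exists_bound_of_continuousOn
    (continuous_complexAction.comp_continuousOn hKcont)
  set M : ℝ := ‖complexAction N A0‖ + 1
  have hM : 0 < M := by positivity
  have hup : ∀ z, ‖complexAction N A0 z‖ ≤ M * ‖z‖ := fun z =>
    (ContinuousLinearMap.le_opNorm _ _).trans (by gcongr; simp [M])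
  obtain ⟨D, c, hD, hc, hdecay⟩ := exists_norm_sq_exp_smul_le (V := EuclideanSpace ℂ (Fin N))
    m M Λ κ (max B 0) hm hM hΛ hκ (le_max_right _ _)
  have hinv : ∀ z, complexAction N A0 (complexAction N A0⁻¹ z) = z := fun z => by
    rw [← mul_apply_eq_comp, ← map_mul, Matrix.mul_nonsing_inv _ hA0.det_pos.ne'.isUnit, map_one]
    rfl
  have hG : ∀ ξ z, complexAction N A0 (hyperbolicSymbol A0 A L ξ z) =
      -((2 * Real.pi * Complex.I : ℂ) • complexAction N (∑ j, ξ j • A j) z +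
        complexAction N L z) := fun ξ z => by
    simp only [hyperbolicSymbol, _root_.neg_apply, mul_apply_eq_comp, map_neg, hinv,
      _root_.add_apply, _root_.smul_apply]
  have hAs : ∀ ξ : EuclideanSpace ℝ (Fin n), (∑ j, ξ j • A j).IsSymm := fun ξ => by
    simp only [Matrix.IsSymm, Matrix.transpose_sum, Matrix.transpose_smul, (hA _).eq]
  obtain ⟨ω₀, hω₀⟩ : ∃ ω₀ : EuclideanSpace ℝ (Fin n), ‖ω₀‖ = 1 :=
    ⟨EuclideanSpace.single ⟨0, hn⟩ 1, by simp⟩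
  refine ⟨D, c, M / m, 2 * ‖complexAction N L‖ / m, hD, hc, by positivity, by positivity,
    fun ξ t ht z => ?_, fun ξ t z => ?_⟩
  · obtain ⟨ω, hω, hξ⟩ : ∃ ω : EuclideanSpace ℝ (Fin n), ‖ω‖ = 1 ∧ ξ = ‖ξ‖ • ω := by
      by_cases h0 : ξ = 0
      · exact ⟨ω₀, hω₀, by simp [h0]⟩
      · exact ⟨‖ξ‖⁻¹ • ξ, by simp [norm_smul, h0], by
          rw [smul_smul, mul_inv_cancel₀ (norm_ne_zero_iff.2 h0), one_smul]⟩
    have hωs : ω ∈ Metric.sphere (0 : EuclideanSpace ℝ (Fin n)) 1 := by simpa using hω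
    have h := hdecay (complexAction N A0) (complexAction N (∑ j, ω j • A j)) (complexAction N L)
      (complexAction N (K ω)) (hyperbolicSymbol A0 A L ξ) (2 * Real.pi * ‖ξ‖) (by positivity)
      (hsymm_re hA0s) hlow hup (hsymm_im (hAs ω)) (fun z => (hl z).2) (fun z => (hl z).1)
      (fun x y => by
        rw [← mul_apply_eq_comp, ← map_mul, inner_complexAction_left, hKskew ω hωs,
          map_neg, _root_.neg_apply, inner_neg_right, map_mul, mul_apply_eq_comp])
      (fun z => by
        have := hcoer ω hωs z
        rwa [_root_.add_apply, inner_add_left, map_mul, mul_apply_eq_comp,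
          Complex.add_re] at this)
      (fun z => (ContinuousLinearMap.le_opNorm _ _).trans (by
        gcongr
        exact (hB ω hωs).trans (le_max_left _ _)))
      (fun z => by
        have : ∑ j, ξ j • A j = ‖ξ‖ • ∑ j, ω j • A j := by
          conv_lhs => rw [hξ]
          simp [Finset.smul_sum, smul_smul]
        rw [hG, this, map_smul, _root_.smul_apply, ← Complex.coe_smul, smul_smul]
        congr 3
        push_cast
        ring) t ht z
    refine h.trans ?_
    have h1 : ‖ξ‖ ^ 2 / (1 + ‖ξ‖ ^ 2) ≤
        (2 * Real.pi * ‖ξ‖) ^ 2 / (1 + (2 * Real.pi * ‖ξ‖) ^ 2) := by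
      rw [div_le_div_iff₀ (by positivity) (by positivity)]
      have : ‖ξ‖ ^ 2 ≤ (2 * Real.pi * ‖ξ‖) ^ 2 := by
        gcongr
        nlinarith [Real.pi_gt_three, norm_nonneg ξ]
      linarith
    gcongr ?_ * Real.exp ?_ * _
    rw [neg_mul, neg_mul, neg_mul, neg_mul]
    gcongr
  · refine norm_sq_exp_smul_le_of_energy hm (hsymm_re hA0s) hlow (fun z => ?_) (fun z => ?_)
      (norm_nonneg _) t z
    · calc _ ≤ ‖inner ℂ (complexAction N A0 z) z‖ := Complex.re_le_norm _
        _ ≤ ‖complexAction N A0 z‖ * ‖z‖ := norm_inner_le_norm _ _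
        _ ≤ M * ‖z‖ * ‖z‖ := by gcongr; exact hup z
        _ = _ := by ring
    · have : (inner ℂ (complexAction N A0 (hyperbolicSymbol A0 A L ξ z)) z).re =
          -(inner ℂ (complexAction N L z) z).re := by
        rw [hG, inner_neg_left, inner_add_left, inner_smul_left]
        simp only [Complex.neg_re, Complex.add_re, Complex.mul_re, hsymm_im (hAs ξ)]
        simp
      rw [this, abs_neg]
      calc _ ≤ ‖inner ℂ (complexAction N L z) z‖ := Complex.abs_re_le_norm _
        _ ≤ ‖complexAction N L z‖ * ‖z‖ := norm_inner_le_norm _ _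
        _ ≤ ‖complexAction N L‖ * ‖z‖ * ‖z‖ := by gcongr; exact ContinuousLinearMap.le_opNorm _ _
        _ = _ := by ring

end MatrixSymbol

section LowFrequency

open scoped ContDiff

variable {E V : Type*} [NormedAddCommGroup E] [InnerProductSpace ℝ E] [FiniteDimensional ℝ E]
  [NormedAddCommGroup V] [InnerProductSpace ℂ V]

/-- Splitting a Schwartz function at height `lam` into a large part and a bounded part. -/
theorem exists_schwartz_truncation (h : 𝓢(E, V)) {p lam : ℝ} (hp1 : 1 ≤ p) (hp2 : p < 2)
    (hl : 0 < lam) : ∃ h₁ h₂ : 𝓢(E, V), h = h₁ + h₂ ∧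
      (∀ x, ‖h₁ x‖ ≤ lam ^ (1 - p) * ‖h x‖ ^ p) ∧
      ∀ x, ‖h₂ x‖ ^ 2 ≤ (2 * lam) ^ (2 - p) * ‖h x‖ ^ p := by
  set χ : E → ℝ := fun x => Real.smoothTransition (‖h x‖ ^ 2 / lam ^ 2 - 1) with hχ
  have hχ0 : ∀ x, ‖h x‖ ≤ lam → χ x = 0 := fun x hx => by
    apply Real.smoothTransition.zero_of_nonpos
    rw [sub_nonpos, div_le_one (by positivity)]
    gcongr
  have hχ1 : ∀ x, 2 * lam ≤ ‖h x‖ → χ x = 1 := fun x hx => by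
    apply Real.smoothTransition.one_of_one_le
    rw [le_sub_iff_add_le, le_div_iff₀ (by positivity)]
    nlinarith
  have hsupp : HasCompactSupport fun x => χ x • h x := by
    have h1 : ∀ᶠ x in Filter.cocompact E, ‖h x‖ < lam := by
      have := (SchwartzMap.tendsto_cocompact h).norm
      rw [norm_zero] at this
      exact this.eventually_lt_const hl
    obtain ⟨s, hs, hsl⟩ := Filter.mem_cocompact.1 h1
    refine HasCompactSupport.intro hs fun x hx => ?_
    rw [hχ0 x (le_of_lt (hsl hx)), zero_smul]
  have hsmooth : ContDiff ℝ ∞ fun x => χ x • h x := by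
    have h1 : ContDiff ℝ ∞ h := h.smooth'
    exact (Real.smoothTransition.contDiff.comp
      (((h1.norm_sq ℂ).div_const _).sub contDiff_const)).smul h1
  have h1x : ∀ x, hsupp.toSchwartzMap hsmooth x = χ x • h x := fun x => rfl
  refine ⟨hsupp.toSchwartzMap hsmooth, h - hsupp.toSchwartzMap hsmooth, by simp,
    fun x => ?_, fun x => ?_⟩
  · rw [h1x]
    rcases le_or_gt ‖h x‖ lam with hx | hx
    · rw [hχ0 x hx, zero_smul, norm_zero]
      positivity
    · have hx0 : 0 < ‖h x‖ := hl.trans hx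
      calc ‖χ x • h x‖ = |χ x| * ‖h x‖ := by rw [norm_smul, Real.norm_eq_abs]
        _ ≤ 1 * ‖h x‖ := by
            gcongr
            rw [abs_of_nonneg (Real.smoothTransition.nonneg _)]
            exact Real.smoothTransition.le_one _
        _ = ‖h x‖ ^ (1 - p) * ‖h x‖ ^ p := by rw [← Real.rpow_add hx0]; simp
        _ ≤ _ := by
            gcongr ?_ * _
            exact Real.rpow_le_rpow_of_nonpos hl hx.le (by linarith)
  · have e : (h - hsupp.toSchwartzMap hsmooth) x = (1 - χ x) • h x := by
      rw [_root_.sub_apply, h1x, sub_smul, one_smul]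
    rw [e]
    rcases le_or_gt (2 * lam) ‖h x‖ with hx | hx
    · rw [hχ1 x hx, sub_self, zero_smul, norm_zero, zero_pow two_ne_zero]
      positivity
    · rcases (norm_nonneg (h x)).eq_or_lt with h0 | hx0
      · rw [norm_smul, ← h0]
        rw [mul_zero, zero_pow two_ne_zero]
        positivity
      calc ‖(1 - χ x) • h x‖ ^ 2 = (|1 - χ x| * ‖h x‖) ^ 2 := by
            rw [norm_smul, Real.norm_eq_abs]
        _ ≤ (1 * ‖h x‖) ^ 2 := by
            gcongr
            rw [abs_of_nonneg (sub_nonneg.2 (Real.smoothTransition.le_one _))]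
            linarith [Real.smoothTransition.nonneg (‖h x‖ ^ 2 / lam ^ 2 - 1)]
        _ = ‖h x‖ ^ (2 - p) * ‖h x‖ ^ p := by
            rw [← Real.rpow_add hx0, one_mul, sub_add_cancel, Real.rpow_two]
        _ ≤ _ := by
            gcongr

variable [MeasurableSpace E] [BorelSpace E]

theorem integrable_rexp_neg_mul_norm_sq {b : ℝ} (hb : 0 < b) :
    Integrable fun ξ : E => Real.exp (-b * ‖ξ‖ ^ 2) := by
  by_contra hi
  have h := GaussianFourier.integral_rexp_neg_mul_sq_norm (V := E) hb
  rw [integral_undef hi] at h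
  have : 0 < (Real.pi / b) ^ (Module.finrank ℝ E / 2 : ℝ) := by positivity
  linarith

theorem integrable_norm_sq_schwartz (h : 𝓢(E, V)) : Integrable fun x => ‖h x‖ ^ 2 :=
  (h.memLp 2 volume).integrable_norm_pow two_ne_zero

theorem integrable_norm_rpow_schwartz (h : 𝓢(E, V)) {p : ℝ} (hp : 0 < p) :
    Integrable fun x => ‖h x‖ ^ p := by
  have := (h.memLp (ENNReal.ofReal p) volume).integrable_norm_rpow
    (by simpa using hp) ENNReal.ofReal_ne_top
  rwa [ENNReal.toReal_ofReal hp.le] at this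

variable [CompleteSpace V]

/-- A Gaussian average of the squared Fourier transform is controlled by the `L^p` norm. -/
theorem integral_gaussian_mul_norm_sq_fourier_le (h : 𝓢(E, V)) {p b Y : ℝ} (hp1 : 1 ≤ p)
    (hp2 : p < 2) (hb : 0 < b) (hY : 0 < Y) (hhY : ∫ x, ‖h x‖ ^ p ≤ Y ^ p) :
    ∫ ξ, Real.exp (-b * ‖ξ‖ ^ 2) * ‖𝓕 h ξ‖ ^ 2 ≤
      2 * (Real.pi ^ (Module.finrank ℝ E / 2 : ℝ) + 2 ^ (2 - p)) *
        b ^ (-(Module.finrank ℝ E * (1 / p - 1 / 2) : ℝ)) * Y ^ 2 := by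
  set d : ℝ := (Module.finrank ℝ E : ℝ)
  have hp0 : 0 < p := by linarith
  set lam : ℝ := b ^ (-(d / (2 * p))) * Y with hlam
  have hl : 0 < lam := by positivity
  obtain ⟨h₁, h₂, rfl, hh₁, hh₂⟩ := exists_schwartz_truncation h hp1 hp2 hl
  set I : ℝ := ∫ x, ‖(h₁ + h₂) x‖ ^ p
  have hI0 : 0 ≤ I := integral_nonneg fun x => by positivity
  have hint : Integrable fun x => ‖(h₁ + h₂) x‖ ^ p := integrable_norm_rpow_schwartz _ hp0
  have hL1 : ∫ x, ‖h₁ x‖ ≤ lam ^ (1 - p) * I := by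
    rw [← integral_const_mul]
    exact integral_mono h₁.integrable.norm (hint.const_mul _) hh₁
  have hL2 : ∫ ξ, ‖𝓕 h₂ ξ‖ ^ 2 ≤ (2 * lam) ^ (2 - p) * I := by
    rw [SchwartzMap.integral_norm_sq_fourier, ← integral_const_mul]
    exact integral_mono (integrable_norm_sq_schwartz h₂) (hint.const_mul _) hh₂
  have hgauss := integrable_rexp_neg_mul_norm_sq (E := E) hb
  have hsup : ∀ ξ, ‖𝓕 h₁ ξ‖ ≤ lam ^ (1 - p) * I := fun ξ =>
    (SchwartzMap.norm_fourier_apply_le_toLp_one h₁ ξ).trans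
      (by rw [SchwartzMap.norm_toLp_one]; exact hL1)
  have hpt : ∀ ξ, Real.exp (-b * ‖ξ‖ ^ 2) * ‖𝓕 (h₁ + h₂) ξ‖ ^ 2 ≤
      2 * (lam ^ (1 - p) * I) ^ 2 * Real.exp (-b * ‖ξ‖ ^ 2) + 2 * ‖𝓕 h₂ ξ‖ ^ 2 := by
    intro ξ
    have hadd : 𝓕 (h₁ + h₂) ξ = 𝓕 h₁ ξ + 𝓕 h₂ ξ := by
      rw [FourierTransform.fourier_add]; rfl
    have h3 : ‖𝓕 (h₁ + h₂) ξ‖ ^ 2 ≤ 2 * ‖𝓕 h₁ ξ‖ ^ 2 + 2 * ‖𝓕 h₂ ξ‖ ^ 2 := by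
      have : ‖𝓕 (h₁ + h₂) ξ‖ ^ 2 ≤ (‖𝓕 h₁ ξ‖ + ‖𝓕 h₂ ξ‖) ^ 2 := by
        rw [hadd]; gcongr; exact norm_add_le _ _
      nlinarith [sq_nonneg (‖𝓕 h₁ ξ‖ - ‖𝓕 h₂ ξ‖)]
    have hexp1 : Real.exp (-b * ‖ξ‖ ^ 2) ≤ 1 :=
      Real.exp_le_one_iff.2 (by nlinarith [sq_nonneg ‖ξ‖])
    have h4 : ‖𝓕 h₁ ξ‖ ^ 2 ≤ (lam ^ (1 - p) * I) ^ 2 := by gcongr; exact hsup ξ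
    calc _ ≤ Real.exp (-b * ‖ξ‖ ^ 2) * (2 * ‖𝓕 h₁ ξ‖ ^ 2 + 2 * ‖𝓕 h₂ ξ‖ ^ 2) := by gcongr
      _ = 2 * ‖𝓕 h₁ ξ‖ ^ 2 * Real.exp (-b * ‖ξ‖ ^ 2) +
          Real.exp (-b * ‖ξ‖ ^ 2) * (2 * ‖𝓕 h₂ ξ‖ ^ 2) := by ring
      _ ≤ 2 * (lam ^ (1 - p) * I) ^ 2 * Real.exp (-b * ‖ξ‖ ^ 2) + 1 * (2 * ‖𝓕 h₂ ξ‖ ^ 2) := by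
          gcongr
      _ = _ := by ring
  have hint2 : Integrable fun ξ => 2 * ‖𝓕 h₂ ξ‖ ^ 2 :=
    (integrable_norm_sq_schwartz (𝓕 h₂)).const_mul 2
  have hmain : ∫ ξ, Real.exp (-b * ‖ξ‖ ^ 2) * ‖𝓕 (h₁ + h₂) ξ‖ ^ 2 ≤
      2 * (lam ^ (1 - p) * I) ^ 2 * (Real.pi / b) ^ (d / 2) + 2 * ((2 * lam) ^ (2 - p) * I) :=
    calc _ ≤ ∫ ξ, (2 * (lam ^ (1 - p) * I) ^ 2 * Real.exp (-b * ‖ξ‖ ^ 2) + 2 * ‖𝓕 h₂ ξ‖ ^ 2) :=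
          integral_mono_of_nonneg (Filter.Eventually.of_forall fun ξ => by positivity)
            ((hgauss.const_mul _).add hint2) (Filter.Eventually.of_forall hpt)
      _ = 2 * (lam ^ (1 - p) * I) ^ 2 * (Real.pi / b) ^ (d / 2) + 2 * ∫ ξ, ‖𝓕 h₂ ξ‖ ^ 2 := by
          rw [integral_add (hgauss.const_mul _) hint2, integral_const_mul, integral_const_mul,
            GaussianFourier.integral_rexp_neg_mul_sq_norm hb]
      _ ≤ _ := by gcongr
  refine hmain.trans ?_
  have e1 : (lam ^ (1 - p) * Y ^ p) ^ 2 * b ^ (-(d / 2)) = b ^ (-(d * (1 / p - 1 / 2))) * Y ^ 2 := by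
    have : (lam ^ (1 - p) * Y ^ p) = b ^ (-(d / (2 * p)) * (1 - p)) * Y := by
      rw [hlam, Real.mul_rpow (by positivity) hY.le, ← Real.rpow_mul hb.le, mul_assoc,
        ← Real.rpow_add hY, sub_add_cancel, Real.rpow_one]
    rw [this, mul_pow, ← Real.rpow_natCast, ← Real.rpow_mul hb.le, mul_right_comm,
      ← Real.rpow_add hb]
    congr 2
    push_cast
    field_simp
    ring
  have e2 : (2 * lam) ^ (2 - p) * Y ^ p =
      2 ^ (2 - p) * (b ^ (-(d * (1 / p - 1 / 2))) * Y ^ 2) := by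
    rw [hlam, Real.mul_rpow (by positivity) (by positivity), Real.mul_rpow (by positivity) hY.le,
      ← Real.rpow_mul hb.le, mul_assoc, mul_assoc, ← Real.rpow_add hY, sub_add_cancel,
      Real.rpow_two]
    congr 3
    field_simp
  have e3 : (Real.pi / b) ^ (d / 2) = Real.pi ^ (d / 2) * b ^ (-(d / 2)) := by
    rw [Real.div_rpow Real.pi_pos.le hb.le, Real.rpow_neg hb.le, div_eq_mul_inv]
  calc _ ≤ 2 * (lam ^ (1 - p) * Y ^ p) ^ 2 * (Real.pi / b) ^ (d / 2) +
        2 * ((2 * lam) ^ (2 - p) * Y ^ p) := by gcongr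
    _ = 2 * Real.pi ^ (d / 2) * ((lam ^ (1 - p) * Y ^ p) ^ 2 * b ^ (-(d / 2))) +
        2 * ((2 * lam) ^ (2 - p) * Y ^ p) := by rw [e3]; ring
    _ = _ := by rw [e1, e2]; ring

theorem exp_neg_rational_le {c t y : ℝ} (hc : 0 ≤ c) (ht : 0 ≤ t) :
    Real.exp (-c * (y ^ 2 / (1 + y ^ 2)) * t) ≤
      Real.exp (-(c / 2) * t) + Real.exp (c / 2) * Real.exp (-(c / 2 * (1 + t)) * y ^ 2) := by
  rcases le_total 1 (y ^ 2) with hy | hy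
  · have h1 : 1 / 2 ≤ y ^ 2 / (1 + y ^ 2) := by
      rw [div_le_div_iff₀ (by positivity) (by positivity)]; linarith
    have h2 : c * t * (1 / 2) ≤ c * t * (y ^ 2 / (1 + y ^ 2)) := by gcongr
    have h3 : Real.exp (-c * (y ^ 2 / (1 + y ^ 2)) * t) ≤ Real.exp (-(c / 2) * t) :=
      Real.exp_le_exp.2 (by linarith)
    have : 0 ≤ Real.exp (c / 2) * Real.exp (-(c / 2 * (1 + t)) * y ^ 2) := by positivity
    linarith
  · have h1 : y ^ 2 / 2 ≤ y ^ 2 / (1 + y ^ 2) := by gcongr; linarith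
    have h2 : c * t * (y ^ 2 / 2) ≤ c * t * (y ^ 2 / (1 + y ^ 2)) := by gcongr
    have h4 : c / 2 * y ^ 2 ≤ c / 2 * 1 := by gcongr
    rw [← Real.exp_add]
    have h3 : Real.exp (-c * (y ^ 2 / (1 + y ^ 2)) * t) ≤
        Real.exp (c / 2 + -(c / 2 * (1 + t)) * y ^ 2) := Real.exp_le_exp.2 (by linarith)
    have := Real.exp_pos (-(c / 2) * t)
    linarith

theorem exists_exp_neg_le_rpow {a α : ℝ} (ha : 0 < a) (hα : 0 < α) :
    ∃ C : ℝ, 0 < C ∧ ∀ t : ℝ, 0 ≤ t → Real.exp (-a * t) ≤ C * (1 + t) ^ (-α) := by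
  refine ⟨(α / a) ^ α * Real.exp a, by positivity, fun t ht => ?_⟩
  have h1 : (1 + t) ^ α ≤ (α / a) ^ α * Real.exp (a * (1 + t)) := by
    have h2 : 1 + t ≤ α / a * Real.exp (a * (1 + t) / α) := by
      have := Real.add_one_le_exp (a * (1 + t) / α)
      calc 1 + t = α / a * (a * (1 + t) / α) := by field_simp
        _ ≤ _ := by gcongr; linarith
    calc (1 + t) ^ α ≤ (α / a * Real.exp (a * (1 + t) / α)) ^ α := by gcongr
      _ = _ := by
        rw [Real.mul_rpow (by positivity) (Real.exp_pos _).le, ← Real.exp_mul]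
        congr 2
        field_simp
  rw [Real.rpow_neg (by linarith), ← div_eq_mul_inv, le_div_iff₀ (by positivity)]
  calc _ ≤ Real.exp (-a * t) * ((α / a) ^ α * Real.exp (a * (1 + t))) := by gcongr
    _ = (α / a) ^ α * (Real.exp (-a * t) * Real.exp (a * (1 + t))) := by ring
    _ = _ := by rw [← Real.exp_add]; congr 2; ring

/-- Polynomial decay of the dissipative multiplier acting on `L² ∩ L^p` data. -/
theorem exists_integral_exp_mul_norm_sq_fourier_le (hE : 0 < Module.finrank ℝ E) {p c : ℝ}
    (hp1 : 1 ≤ p) (hp2 : p < 2) (hc : 0 < c) :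
    ∃ C : ℝ, 0 < C ∧ ∀ (h : 𝓢(E, V)) (Y : ℝ), 0 ≤ Y → ∫ x, ‖h x‖ ^ p ≤ Y ^ p →
      ∀ t : ℝ, 0 ≤ t →
      Integrable (fun ξ => Real.exp (-c * (‖ξ‖ ^ 2 / (1 + ‖ξ‖ ^ 2)) * t) * ‖𝓕 h ξ‖ ^ 2) ∧
      ∫ ξ, Real.exp (-c * (‖ξ‖ ^ 2 / (1 + ‖ξ‖ ^ 2)) * t) * ‖𝓕 h ξ‖ ^ 2 ≤
        C * (1 + t) ^ (-(Module.finrank ℝ E * (1 / p - 1 / 2) : ℝ)) *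
          ((∫ x, ‖h x‖ ^ 2) + Y ^ 2) := by
  set d : ℝ := (Module.finrank ℝ E : ℝ)
  have hp0 : 0 < p := by linarith
  have hd : 0 < d := by simpa [d] using hE
  set α : ℝ := d * (1 / p - 1 / 2) with hα
  have hα0 : 0 < α := mul_pos hd (sub_pos.2 (one_div_lt_one_div_of_lt hp0 hp2))
  obtain ⟨C₁, hC₁, hexp⟩ := exists_exp_neg_le_rpow (half_pos hc) hα0
  set C₂ : ℝ := Real.exp (c / 2) * (2 * (Real.pi ^ (d / 2) + 2 ^ (2 - p)) * (c / 2) ^ (-α))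
  have hC₂ : 0 < C₂ := by positivity
  refine ⟨C₁ + C₂, by positivity, fun h Y hY hhY t ht => ?_⟩
  have hFint := integrable_norm_sq_schwartz (𝓕 h)
  have hcont : Continuous fun ξ => 𝓕 h ξ := (𝓕 h).continuous
  have hdom : ∀ f : E → ℝ, Continuous f → (∀ ξ, 0 ≤ f ξ) → (∀ ξ, f ξ ≤ 1) →
      Integrable fun ξ => f ξ * ‖𝓕 h ξ‖ ^ 2 := fun f hf h0 h1 => by
    refine hFint.mono' (by fun_prop) (Filter.Eventually.of_forall fun ξ => ?_)
    rw [Real.norm_of_nonneg (mul_nonneg (h0 ξ) (sq_nonneg _))]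
    exact mul_le_of_le_one_left (sq_nonneg _) (h1 ξ)
  have hb : 0 < c / 2 * (1 + t) := by positivity
  have hint₁ : Integrable fun ξ => Real.exp (-(c / 2 * (1 + t)) * ‖ξ‖ ^ 2) * ‖𝓕 h ξ‖ ^ 2 :=
    hdom _ (by fun_prop) (fun _ => (Real.exp_pos _).le) fun ξ =>
      Real.exp_le_one_iff.2 (by nlinarith [sq_nonneg ‖ξ‖])
  have hlow : ∫ ξ, Real.exp (-(c / 2 * (1 + t)) * ‖ξ‖ ^ 2) * ‖𝓕 h ξ‖ ^ 2 ≤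
      2 * (Real.pi ^ (d / 2) + 2 ^ (2 - p)) * (c / 2 * (1 + t)) ^ (-α) * Y ^ 2 := by
    have hcY : Continuous fun y : ℝ =>
      2 * (Real.pi ^ (d / 2) + 2 ^ (2 - p)) * (c / 2 * (1 + t)) ^ (-α) * y ^ 2 := by fun_prop
    refine ge_of_tendsto (hcY.continuousWithinAt (s := Set.Ioi Y)) ?_
    filter_upwards [self_mem_nhdsWithin] with y hy
    exact integral_gaussian_mul_norm_sq_fourier_le h hp1 hp2 hb (hY.trans_lt hy)
      (hhY.trans (by gcongr; exact le_of_lt hy))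
  refine ⟨hdom _ ?_ (fun _ => (Real.exp_pos _).le) fun ξ => Real.exp_le_one_iff.2 ?_, ?_⟩
  · have : ∀ ξ : E, 1 + ‖ξ‖ ^ 2 ≠ 0 := fun ξ => by positivity
    fun_prop (disch := assumption)
  · have : 0 ≤ c * (‖ξ‖ ^ 2 / (1 + ‖ξ‖ ^ 2)) * t := by positivity
    linarith
  calc _ ≤ ∫ ξ, (Real.exp (-(c / 2) * t) * ‖𝓕 h ξ‖ ^ 2 +
        Real.exp (c / 2) * (Real.exp (-(c / 2 * (1 + t)) * ‖ξ‖ ^ 2) * ‖𝓕 h ξ‖ ^ 2)) := by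
        refine integral_mono_of_nonneg (Filter.Eventually.of_forall fun ξ => by positivity)
          ((hFint.const_mul _).add (hint₁.const_mul _)) (Filter.Eventually.of_forall fun ξ => ?_)
        have := mul_le_mul_of_nonneg_right (exp_neg_rational_le (y := ‖ξ‖) hc.le ht)
          (sq_nonneg ‖𝓕 h ξ‖)
        linarith
    _ = Real.exp (-(c / 2) * t) * (∫ x, ‖h x‖ ^ 2) +
        Real.exp (c / 2) * ∫ ξ, Real.exp (-(c / 2 * (1 + t)) * ‖ξ‖ ^ 2) * ‖𝓕 h ξ‖ ^ 2 := by
        rw [integral_add (hFint.const_mul _) (hint₁.const_mul _), integral_const_mul,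
          integral_const_mul, SchwartzMap.integral_norm_sq_fourier]
    _ ≤ C₁ * (1 + t) ^ (-α) * (∫ x, ‖h x‖ ^ 2) + Real.exp (c / 2) *
        (2 * (Real.pi ^ (d / 2) + 2 ^ (2 - p)) * (c / 2 * (1 + t)) ^ (-α) * Y ^ 2) := by
        gcongr
        exact hexp t ht
    _ = C₁ * (1 + t) ^ (-α) * (∫ x, ‖h x‖ ^ 2) + C₂ * (1 + t) ^ (-α) * Y ^ 2 := by
        rw [Real.mul_rpow (by positivity) (by positivity)]; ring
    _ ≤ C₁ * (1 + t) ^ (-α) * (∫ x, ‖h x‖ ^ 2) + C₂ * (1 + t) ^ (-α) * Y ^ 2 +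
        (C₂ * (1 + t) ^ (-α) * (∫ x, ‖h x‖ ^ 2) + C₁ * (1 + t) ^ (-α) * Y ^ 2) := by
        have : 0 ≤ ∫ x, ‖h x‖ ^ 2 := integral_nonneg fun x => by positivity
        have : 0 ≤ C₂ * (1 + t) ^ (-α) * (∫ x, ‖h x‖ ^ 2) + C₁ * (1 + t) ^ (-α) * Y ^ 2 := by
          positivity
        linarith
    _ = _ := by ring

end LowFrequency

section Evolution

open scoped LineDeriv

variable {n N : ℕ}

/-- The coordinatewise inclusion of real vectors into complex Euclidean space. -/
noncomputable def complexify (N : ℕ) : (Fin N → ℝ) →L[ℝ] EuclideanSpace ℂ (Fin N) :=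
  LinearMap.toContinuousLinearMap
    { toFun := fun v => WithLp.toLp 2 fun i => (v i : ℂ)
      map_add' := fun v w => by ext i; simp
      map_smul' := fun r v => by ext i; simp }

theorem complexify_apply (v : Fin N → ℝ) (i : Fin N) : complexify N v i = (v i : ℂ) := rfl

theorem complexAction_complexify (M : Matrix (Fin N) (Fin N) ℝ) (v : Fin N → ℝ) :
    complexAction N M (complexify N v) = complexify N (M *ᵥ v) := by
  ext i
  simp [complexAction_apply, complexify_apply, Matrix.mulVec, dotProduct]

theorem norm_le_norm_complexify (v : Fin N → ℝ) : ‖v‖ ≤ ‖complexify N v‖ := by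
  refine (pi_norm_le_iff_of_nonneg (norm_nonneg _)).2 fun i => ?_
  have := PiLp.norm_apply_le (complexify N v) i
  rwa [complexify_apply, Complex.norm_real] at this

theorem fourier_postcompCLM {E V : Type*} [NormedAddCommGroup E] [InnerProductSpace ℝ E]
    [FiniteDimensional ℝ E] [MeasurableSpace E] [BorelSpace E] [NormedAddCommGroup V]
    [InnerProductSpace ℂ V] [CompleteSpace V] (T : V →L[ℂ] V) (f : 𝓢(E, V)) (ξ : E) :
    𝓕 (f.postcompCLM T) ξ = T (𝓕 f ξ) := by
  rw [SchwartzMap.fourier_coe, SchwartzMap.fourier_coe, Real.fourier_eq, Real.fourier_eq,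
    ← T.integral_comp_comm]
  · refine integral_congr_ae (Filter.Eventually.of_forall fun x => ?_)
    simp [Circle.smul_def]
  · exact (Real.fourierIntegral_convergent_iff ξ).2 f.integrable

/-- The spatial operator `-(A⁰)⁻¹ (∑ Aʲ ∂ⱼ + L)` on complex Schwartz functions. -/
noncomputable def spatialOperator (A0 : Matrix (Fin N) (Fin N) ℝ)
    (A : Fin n → Matrix (Fin N) (Fin N) ℝ) (L : Matrix (Fin N) (Fin N) ℝ)
    (f : 𝓢(EuclideanSpace ℝ (Fin n), EuclideanSpace ℂ (Fin N))) :
    𝓢(EuclideanSpace ℝ (Fin n), EuclideanSpace ℂ (Fin N)) :=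
  -SchwartzMap.postcompCLM (complexAction N A0⁻¹)
    ((∑ j, SchwartzMap.postcompCLM (complexAction N (A j)) (∂_{EuclideanSpace.single j (1 : ℝ)} f)) +
      SchwartzMap.postcompCLM (complexAction N L) f)

theorem schwartz_sum_apply {ι E V : Type*} [NormedAddCommGroup E] [NormedSpace ℝ E]
    [NormedAddCommGroup V] [NormedSpace ℝ V] (s : Finset ι) (f : ι → 𝓢(E, V)) (x : E) :
    (∑ j ∈ s, f j) x = ∑ j ∈ s, f j x := by
  classical
  induction s using Finset.induction_on with
  | empty => simp
  | insert a s ha ih => simp [Finset.sum_insert ha, ih]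

theorem fourier_spatialOperator (A0 : Matrix (Fin N) (Fin N) ℝ)
    (A : Fin n → Matrix (Fin N) (Fin N) ℝ) (L : Matrix (Fin N) (Fin N) ℝ)
    (f : 𝓢(EuclideanSpace ℝ (Fin n), EuclideanSpace ℂ (Fin N))) (ξ : EuclideanSpace ℝ (Fin n)) :
    𝓕 (spatialOperator A0 A L f) ξ = hyperbolicSymbol A0 A L ξ (𝓕 f ξ) := by
  have hd : ∀ j, 𝓕 (∂_{EuclideanSpace.single j (1 : ℝ)} f :
      𝓢(EuclideanSpace ℝ (Fin n), EuclideanSpace ℂ (Fin N))) ξ =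
      (2 * Real.pi * Complex.I : ℂ) • ξ j • 𝓕 f ξ := fun j => by
    have hg : (inner ℝ · (EuclideanSpace.single j (1 : ℝ)) :
        EuclideanSpace ℝ (Fin n) → ℝ).HasTemperateGrowth := by fun_prop
    rw [SchwartzMap.fourier_lineDerivOp_eq, _root_.smul_apply,
      SchwartzMap.smulLeftCLM_apply_apply hg]
    simp [EuclideanSpace.inner_single_right]
  have hsum : 𝓕 (∑ j, SchwartzMap.postcompCLM (complexAction N (A j))
      (∂_{EuclideanSpace.single j (1 : ℝ)} f)) =
      ∑ j, 𝓕 (SchwartzMap.postcompCLM (complexAction N (A j))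
        (∂_{EuclideanSpace.single j (1 : ℝ)} f)) :=
    map_sum (SchwartzMap.fourierTransformCLM ℂ) _ _
  rw [spatialOperator, FourierTransform.fourier_neg, _root_.neg_apply, fourier_postcompCLM,
    FourierTransform.fourier_add, _root_.add_apply, hsum, schwartz_sum_apply]
  simp only [fourier_postcompCLM, hd, hyperbolicSymbol, _root_.neg_apply, mul_apply_eq_comp,
    _root_.add_apply, _root_.smul_apply, map_sum, map_smul, _root_.sum_apply,
    Finset.smul_sum]
  simp only [← Complex.coe_smul, map_smul]

theorem spatialOperator_postcompCLM_apply {A0 : Matrix (Fin N) (Fin N) ℝ} (hA0 : A0.PosDef)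
    (A : Fin n → Matrix (Fin N) (Fin N) ℝ) (L : Matrix (Fin N) (Fin N) ℝ)
    (u : 𝓢(EuclideanSpace ℝ (Fin n), Fin N → ℝ)) {x : EuclideanSpace ℝ (Fin n)} {v : Fin N → ℝ}
    (h : A0 *ᵥ v + (∑ j, A j *ᵥ fderiv ℝ u x (EuclideanSpace.single j 1)) + L *ᵥ u x = 0) :
    spatialOperator A0 A L (u.postcompCLM (complexify N)) x = complexify N v := by
  have hd : ∀ m, (∂_{m} (u.postcompCLM (complexify N)) :
      𝓢(EuclideanSpace ℝ (Fin n), EuclideanSpace ℂ (Fin N))) x =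
      complexify N (fderiv ℝ u x m) := by
    intro m
    rw [SchwartzMap.lineDerivOp_apply_eq_fderiv]
    have := ((complexify N).hasFDerivAt.comp x u.differentiableAt.hasFDerivAt).fderiv
    have e : ⇑(u.postcompCLM (complexify N)) = complexify N ∘ u := rfl
    rw [e, this]
    rfl
  have hv : v = -(A0⁻¹ *ᵥ ((∑ j, A j *ᵥ fderiv ℝ u x (EuclideanSpace.single j 1)) + L *ᵥ u x)) := by
    have h1 : A0 *ᵥ v =
        -((∑ j, A j *ᵥ fderiv ℝ u x (EuclideanSpace.single j 1)) + L *ᵥ u x) := by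
      rw [eq_neg_iff_add_eq_zero, ← add_assoc, h]
    rw [← Matrix.mulVec_neg, ← h1, Matrix.mulVec_mulVec,
      Matrix.nonsing_inv_mul _ hA0.det_pos.ne'.isUnit, Matrix.one_mulVec]
  rw [hv, spatialOperator, _root_.neg_apply, SchwartzMap.postcompCLM_apply, _root_.add_apply,
    schwartz_sum_apply]
  simp only [SchwartzMap.postcompCLM_apply, hd, complexAction_complexify, map_neg]
  rw [← map_sum, ← map_add, complexAction_complexify]

/-- On the Fourier side, a solution evolves by the exponential of the symbol. -/
theorem ae_fourier_solution_eq_exp {A0 : Matrix (Fin N) (Fin N) ℝ} (hA0 : A0.PosDef)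
    (A : Fin n → Matrix (Fin N) (Fin N) ℝ) (L : Matrix (Fin N) (Fin N) ℝ) {D c : ℝ}
    (hD : 0 ≤ D) (hc : 0 ≤ c)
    (hexp : ∀ ξ : EuclideanSpace ℝ (Fin n), ∀ t : ℝ, ∀ z,
      ‖NormedSpace.exp (t • hyperbolicSymbol A0 A L ξ) z‖ ^ 2 ≤
        D * Real.exp (c * |t|) * ‖z‖ ^ 2)
    {w : ℝ → 𝓢(EuclideanSpace ℝ (Fin n), Fin N → ℝ)}
    {wt : ℝ → EuclideanSpace ℝ (Fin n) → (Fin N → ℝ)}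
    (hw : ∀ x t, 0 ≤ t → HasDerivAt (fun s => w s x) (wt t x) t)
    (hwt : ∀ x, ContinuousOn (fun t => wt t x) (Set.Ici 0))
    (hpde : ∀ t : ℝ, 0 ≤ t → ∀ x, A0 *ᵥ wt t x +
      (∑ j, A j *ᵥ fderiv ℝ (w t) x (EuclideanSpace.single j 1)) + L *ᵥ w t x = 0)
    {t : ℝ} (ht : 0 ≤ t) :
    ∀ᵐ ξ, 𝓕 ((w t).postcompCLM (complexify N)) ξ =
      NormedSpace.exp (t • hyperbolicSymbol A0 A L ξ) (𝓕 ((w 0).postcompCLM (complexify N)) ξ) := by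
  set f : ℝ → 𝓢(EuclideanSpace ℝ (Fin n), EuclideanSpace ℂ (Fin N)) :=
    fun t => (w (max t 0)).postcompCLM (complexify N) with hf
  have hfx : ∀ t x, f t x = complexify N (w (max t 0) x) := fun t x => rfl
  have hgx : ∀ t x, spatialOperator A0 A L (f t) x = complexify N (wt (max t 0) x) := fun t x =>
    spatialOperator_postcompCLM_apply hA0 A L _ (hpde _ (le_max_right _ _) x)
  have hclip : ∀ {h : ℝ → Fin N → ℝ}, ContinuousOn h (Set.Ici 0) →
      Continuous fun t => complexify N (h (max t 0)) := fun hh =>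
    (complexify N).continuous.comp (hh.comp_continuous (by fun_prop) fun t => le_max_right t 0)
  have hfc : ∀ x, Continuous fun t => f t x := fun x =>
    hclip fun s hs => (hw x s hs).continuousAt.continuousWithinAt
  have hgc : ∀ x, Continuous fun t => spatialOperator A0 A L (f t) x := fun x => by
    simp only [hgx]
    exact hclip (hwt x)
  have hfg : ∀ s t, 0 ≤ s → 0 ≤ t → ∀ x,
      f t x = f s x + ∫ r in s..t, spatialOperator A0 A L (f r) x := by
    intro s t hs ht x
    have h := intervalIntegral.integral_eq_sub_of_hasDerivAt
      (f := fun r => complexify N (w r x)) (f' := fun r => spatialOperator A0 A L (f r) x)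
      (a := s) (b := t) (fun r hr => by
        have hr0 : 0 ≤ r := (le_min hs ht).trans hr.1
        rw [hgx, max_eq_left hr0]
        exact (complexify N).hasFDerivAt.comp_hasDerivAt r (hw x r hr0))
      ((hgc x).intervalIntegrable _ _)
    rw [h, hfx, hfx, max_eq_left hs, max_eq_left ht]
    abel
  have := ae_fourier_eq_exp hD hc hfc hgc hfg
    (fun t ξ => fourier_spatialOperator A0 A L (f t) ξ) hexp ht
  simpa only [hf, max_eq_left ht, max_self] using this

theorem toReal_eLpNorm_rpow_schwartz {E V : Type*} [NormedAddCommGroup E] [InnerProductSpace ℝ E]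
    [FiniteDimensional ℝ E] [MeasurableSpace E] [BorelSpace E] [NormedAddCommGroup V]
    [NormedSpace ℝ V] (h : 𝓢(E, V)) {p : ℝ} (hp : 0 < p) :
    (eLpNorm h (ENNReal.ofReal p) volume).toReal ^ p = ∫ x, ‖h x‖ ^ p := by
  have hI : 0 ≤ ∫ x, ‖h x‖ ^ p := integral_nonneg fun x => by positivity
  rw [MemLp.eLpNorm_eq_integral_rpow_norm (by simpa using hp) ENNReal.ofReal_ne_top (h.memLp _ _),
    ENNReal.toReal_ofReal hp.le, ENNReal.toReal_ofReal (by positivity), ← Real.rpow_mul hI,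
    inv_mul_cancel₀ hp.ne', Real.rpow_one]

end Evolution

theorem statement13 (n N : ℕ) (hn : 1 ≤ n) (hN : 1 ≤ N)
    (A0 : Matrix (Fin N) (Fin N) ℝ) (A : Fin n → Matrix (Fin N) (Fin N) ℝ)
    (L : Matrix (Fin N) (Fin N) ℝ)
    (hA0 : A0.PosDef) (hA0s : A0.IsSymm) (hA : ∀ j, (A j).IsSymm)
    (hL : L.PosSemidef) (hLs : L.IsSymm)
    -- the [SK] hypothesis
    (K : EuclideanSpace ℝ (Fin n) → Matrix (Fin N) (Fin N) ℝ)
    (hKcont : ContinuousOn K (Metric.sphere (0 : EuclideanSpace ℝ (Fin n)) 1))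
    (hKodd : ∀ ω ∈ Metric.sphere (0 : EuclideanSpace ℝ (Fin n)) 1, K (-ω) = -(K ω))
    (hKskew : ∀ ω ∈ Metric.sphere (0 : EuclideanSpace ℝ (Fin n)) 1,
      (K ω * A0).transpose = -(K ω * A0))
    (hKA : ∀ ω ∈ Metric.sphere (0 : EuclideanSpace ℝ (Fin n)) 1,
      (symPart (K ω * ∑ j, ω j • A j) + L).PosDef)
    (p : ℝ) (hp1 : 1 ≤ p) (hp2 : p < 2) :
    ∃ C : ℝ, 0 < C ∧
      ∀ (w : ℝ → SchwartzMap (EuclideanSpace ℝ (Fin n)) (Fin N → ℝ))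
        (wt : ℝ → EuclideanSpace ℝ (Fin n) → (Fin N → ℝ)),
        (∀ (x : EuclideanSpace ℝ (Fin n)) (t : ℝ), 0 ≤ t →
          HasDerivAt (fun s => w s x) (wt t x) t) →
        (∀ x : EuclideanSpace ℝ (Fin n), ContinuousOn (fun t => wt t x) (Set.Ici 0)) →
        (∀ t : ℝ, 0 ≤ t → ∀ x : EuclideanSpace ℝ (Fin n),
          A0.mulVec (wt t x)
            + (∑ j, (A j).mulVec (fderiv ℝ (⇑(w t)) x (EuclideanSpace.single j 1)))
            + L.mulVec (w t x) = 0) →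
        ∀ t : ℝ, 0 ≤ t →
          eLpNorm (⇑(w t)) 2 volume
            ≤ ENNReal.ofReal (C * (1 + t) ^ (-((n : ℝ) / 2) * (1 / p - 1 / 2)))
              * (eLpNorm (⇑(w 0)) 2 volume + eLpNorm (⇑(w 0)) (ENNReal.ofReal p) volume) := by
  obtain ⟨D, c, D', c', hD, hc, hD', hc', hdecay, hgrowth⟩ :=
    exists_norm_sq_exp_hyperbolicSymbol_le hn A0 A L hA0 hA0s hA hL K hKcont hKskew hKA
  have hp0 : 0 < p := by linarith
  obtain ⟨C, hC, hbound⟩ := exists_integral_exp_mul_norm_sq_fourier_le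
    (E := EuclideanSpace ℝ (Fin n)) (V := EuclideanSpace ℂ (Fin N)) (p := p) (c := c)
    (by rw [finrank_euclideanSpace_fin]; exact hn) hp1 hp2 hc
  set B : ℝ := ‖complexify N‖ + 1
  have hB : 0 < B := by positivity
  refine ⟨√(D * C) * B, by positivity, fun w wt hw hwt hpde t ht => ?_⟩
  set γ : ℝ := -((n : ℝ) / 2) * (1 / p - 1 / 2)
  set W : ℝ → 𝓢(EuclideanSpace ℝ (Fin n), EuclideanSpace ℂ (Fin N)) :=
    fun s => (w s).postcompCLM (complexify N)
  have htwo : ∀ h : 𝓢(EuclideanSpace ℝ (Fin n), EuclideanSpace ℂ (Fin N)),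
      ∫ x, ‖h x‖ ^ 2 = (eLpNorm h 2 volume).toReal ^ 2 := fun h => by
    have := toReal_eLpNorm_rpow_schwartz h two_pos
    simpa using this.symm
  set a : ℝ := (eLpNorm (W 0) 2 volume).toReal
  set Y : ℝ := (eLpNorm (W 0) (ENNReal.ofReal p) volume).toReal
  obtain ⟨hint, hle⟩ := hbound (W 0) Y ENNReal.toReal_nonneg
    (toReal_eLpNorm_rpow_schwartz (W 0) hp0).ge t ht
  have hsq : (eLpNorm (W t) 2 volume).toReal ^ 2 ≤
      (√(D * C) * (1 + t) ^ γ * (a + Y)) ^ 2 := by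
    rw [← htwo, ← SchwartzMap.integral_norm_sq_fourier]
    calc ∫ ξ, ‖𝓕 (W t) ξ‖ ^ 2
        ≤ ∫ ξ, D * (Real.exp (-c * (‖ξ‖ ^ 2 / (1 + ‖ξ‖ ^ 2)) * t) * ‖𝓕 (W 0) ξ‖ ^ 2) := by
          refine integral_mono_of_nonneg (Filter.Eventually.of_forall fun ξ => by positivity)
            (hint.const_mul D) ?_
          filter_upwards [ae_fourier_solution_eq_exp hA0 A L hD' hc' hgrowth hw hwt hpde ht] with ξ hξ
          simp only [W, hξ]
          exact (hdecay ξ t ht _).trans_eq (by ring)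
      _ ≤ D * (C * (1 + t) ^ (2 * γ) * (a ^ 2 + Y ^ 2)) := by
          rw [integral_const_mul, ← htwo]
          refine mul_le_mul_of_nonneg_left (hle.trans_eq ?_) hD.le
          simp only [finrank_euclideanSpace, Fintype.card_fin, γ]
          congr 3
          ring
      _ ≤ D * (C * (1 + t) ^ (2 * γ) * (a + Y) ^ 2) := by
          gcongr
          have : 0 ≤ a * Y := mul_nonneg ENNReal.toReal_nonneg ENNReal.toReal_nonneg
          linarith [add_sq a Y]
      _ = _ := by
          have e : ((1 + t) ^ γ) ^ 2 = (1 + t) ^ (2 * γ) := by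
            rw [← Real.rpow_natCast, ← Real.rpow_mul (by linarith), mul_comm γ, Nat.cast_ofNat]
          rw [mul_pow, mul_pow, Real.sq_sqrt (by positivity), e]
          ring
  have hlin : (eLpNorm (W t) 2 volume).toReal ≤ √(D * C) * (1 + t) ^ γ * (a + Y) :=
    le_of_sq_le_sq hsq (by positivity)
  have hfin : ∀ q, eLpNorm (W 0) q volume ≠ ∞ := fun q => ((W 0).memLp q volume).2.ne
  have hWw : ∀ q, eLpNorm (W 0) q volume ≤ ENNReal.ofReal B * eLpNorm (w 0) q volume := fun q =>
    eLpNorm_le_mul_eLpNorm_of_ae_le_mul (Filter.Eventually.of_forall fun x =>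
      ((complexify N).le_opNorm _).trans (by gcongr; simp [B])) q
  calc eLpNorm (w t) 2 volume ≤ eLpNorm (W t) 2 volume :=
        eLpNorm_mono fun x => norm_le_norm_complexify _
    _ = ENNReal.ofReal (eLpNorm (W t) 2 volume).toReal := (ENNReal.ofReal_toReal ((W t).memLp 2 volume).2.ne).symm
    _ ≤ ENNReal.ofReal (√(D * C) * (1 + t) ^ γ * (a + Y)) := ENNReal.ofReal_le_ofReal hlin
    _ = ENNReal.ofReal (√(D * C) * (1 + t) ^ γ) *
        (eLpNorm (W 0) 2 volume + eLpNorm (W 0) (ENNReal.ofReal p) volume) := by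
        rw [ENNReal.ofReal_mul (by positivity), ENNReal.ofReal_add ENNReal.toReal_nonneg
          ENNReal.toReal_nonneg, ENNReal.ofReal_toReal (hfin _), ENNReal.ofReal_toReal (hfin _)]
    _ ≤ ENNReal.ofReal (√(D * C) * (1 + t) ^ γ) * (ENNReal.ofReal B * eLpNorm (w 0) 2 volume +
        ENNReal.ofReal B * eLpNorm (w 0) (ENNReal.ofReal p) volume) := by
        gcongr <;> exact hWw _
    _ = _ := by
        rw [← mul_add, ← mul_assoc, ← ENNReal.ofReal_mul (by positivity), mul_right_comm]
end
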